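/- Let G = (V,E) be a directed graph with a legal partition V = V_1 ∪ … ∪ V_m, with index sets U₁ = U₁^S ∪ U₁^S̄ and U₂ as defined, n_k = |V_k|, and local fractional weak domination numbers δ*_k for k ∈ U₂; assume U₂ ≠ ∅. Then there exists T₀ (depending on G and the partition) such that for every T ≥ T₀ there is a policy whose regret satisfies, for every loss sequence ℓ^(1),…,ℓ^(T):V→[0,1] and every arm a ∈ V lying in block V_{k*}: (1) if U₁^S̄ = ∅, R_a(T) ≤ 3·(2·Σ_{k∈U₂}√(n_k))^{1/3}·n_{k*}^{1/6}·T^{2/3} + 3·2^{2/3}·(|U₂|·Σ_{k∈U₂}(δ*_k)²)^{1/6}·T^{2/3} + 4√(|U₁^S|)·T^{1/2}; (2) if U₁^S̄ ≠ ∅, R_a(T) ≤ 6·2^{1/3}·(|U₂|·Σ_{k∈U₂}(δ*_k)²)^{1/6}·T^{2/3} + 3·(2·Σ_{k∈U₂}√(n_k))^{1/3}·n_{k*}^{1/6}·T^{2/3} + 4√(6|U₁^S|)·T^{1/2} + 2√(10·log(|U₁^S̄|+1))·T^{1/2} + 4·|U₂|^{5/6}·T^{1/3}/(2^{1/3}·(Σ_{k∈U₂}(δ*_k)²)^{1/6})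 + (√6/3)·T^{1/2}. -/

import Mathlib

open scoped BigOperators

/-- A policy maps the chronological history of (arm, feedback) pairs to a
probability distribution over arms.  The feedback after playing arm `a` is
recorded as a function `V → Option ℝ`, giving the observed loss on the
out-neighbors of `a` and `none` elsewhere. -/
def Policy (V : Type) : Type :=
  List (V × (V → Option ℝ)) → PMF V

/-- The feedback revealed when arm `a` is played against the loss vector `ℓ`:
exactly the values `ℓ j` for out-neighbors `j` of `a`. -/
def feedbackOf {V : Type} (E : V → V → Bool) (ℓ : V → ℝ) (a : V) : V → Option ℝ :=
  fun j => if E a j then some (ℓ j) else none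

/-- The chronological history produced by playing the arm sequence `as`
against the loss sequence `ℓ`. -/
def hist {V : Type} (E : V → V → Bool) (ℓ : ℕ → V → ℝ) (as : List V) :
    List (V × (V → Option ℝ)) :=
  (List.range as.length).zipWith (fun t a => (a, feedbackOf E (ℓ t) a)) as

/-- Probability that the policy `π` plays exactly the arm sequence `as`
during the first `T` rounds. -/
noncomputable def seqProb {V : Type} [Fintype V] (π : Policy V) (E : V → V → Bool)
    (ℓ : ℕ → V → ℝ) (T : ℕ) (as : Fin T → V) : ℝ :=
  ∏ t : Fin T, (π (hist E ℓ ((List.ofFn as).take t.val)) (as t)).toReal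

/-- Expected cumulative loss of the policy `π` over `T` rounds. -/
noncomputable def expectedLoss {V : Type} [Fintype V] (π : Policy V) (E : V → V → Bool)
    (ℓ : ℕ → V → ℝ) (T : ℕ) : ℝ :=
  ∑ as : Fin T → V, seqProb π E ℓ T as * ∑ t : Fin T, ℓ t.val (as t)

/-- Regret of the policy `π` with respect to the fixed arm `a`. -/
noncomputable def regretTo {V : Type} [Fintype V] (π : Policy V) (E : V → V → Bool)
    (ℓ : ℕ → V → ℝ) (T : ℕ) (a : V) : ℝ :=
  expectedLoss π E ℓ T - ∑ t : Fin T, ℓ t.val a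

/-- Regret of the policy `π` with respect to the best fixed arm. -/
noncomputable def regret {V : Type} [Fintype V] (π : Policy V) (E : V → V → Bool)
    (ℓ : ℕ → V → ℝ) (T : ℕ) : ℝ :=
  expectedLoss π E ℓ T - ⨅ a : V, ∑ t : Fin T, ℓ t.val a

/-- A loss sequence taking values in `[0,1]`. -/
def ValidLoss {V : Type} (ℓ : ℕ → V → ℝ) : Prop :=
  ∀ t v, 0 ≤ ℓ t v ∧ ℓ t v ≤ 1

/-- The mini-max regret of the feedback graph `E` on `V` at horizon `T`. -/
noncomputable def minimaxRegret (V : Type) [Fintype V] (E : V → V → Bool) (T : ℕ) : ℝ :=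
  ⨅ π : Policy V, ⨆ ℓ : {ℓ : ℕ → V → ℝ // ValidLoss ℓ}, regret π E ℓ.1 T

/-- A vertex is observable if it has an in-neighbor. -/
def ObservableVertex {V : Type} (E : V → V → Bool) (v : V) : Prop :=
  ∃ u, E u v

/-- A vertex is strongly observable if it has a self-loop or is observed by
all other vertices. -/
def StronglyObservableVertex {V : Type} (E : V → V → Bool) (v : V) : Prop :=
  E v v ∨ ∀ u, u ≠ v → E u v

/-- A graph is observable if every vertex is observable. -/
def Observable {V : Type} (E : V → V → Bool) : Prop :=
  ∀ v, ObservableVertex E v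

/-- A graph is strongly observable if every vertex is strongly observable. -/
def StronglyObservable {V : Type} (E : V → V → Bool) : Prop :=
  ∀ v, StronglyObservableVertex E v

/-- A graph is weakly observable if it is observable but not strongly
observable. -/
def WeaklyObservable {V : Type} (E : V → V → Bool) : Prop :=
  Observable E ∧ ¬ StronglyObservable E

/-- Feasibility for the local linear program on a block `S`:
`0 ≤ x_v ≤ 1` for `v ∈ S` and `Σ_{v ∈ N_in(u) ∩ S} x_v ≥ 1` for every `u ∈ S`. -/
def LPFeasible {V : Type} [Fintype V] (E : V → V → Bool) (S : Finset V)
    (x : V → ℝ) : Prop :=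
  (∀ v ∈ S, 0 ≤ x v ∧ x v ≤ 1) ∧
  ∀ u ∈ S, 1 ≤ ∑ v ∈ S.filter (fun v => E v u), x v

/-- `δ` is the local fractional weak domination number of the block `S`, i.e. the
optimum value of the local linear program. -/
def IsLocalFracWeakDomNumber {V : Type} [Fintype V] (E : V → V → Bool)
    (S : Finset V) (δ : ℝ) : Prop :=
  (∃ x : V → ℝ, LPFeasible E S x ∧ ∑ v ∈ S, x v = δ) ∧
  ∀ x : V → ℝ, LPFeasible E S x → δ ≤ ∑ v ∈ S, x v

section Tsallis

variable {ι : Type*}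

/-- `y` is the point of the simplex on `s` at which the linear functional `G` regularized by the
Tsallis entropy `-∑ 2 √y / η` is stationary. -/
structure IsTsallisPoint (s : Finset ι) (η G y : ι → ℝ) : Prop where
  pos : ∀ j ∈ s, 0 < y j
  sum_eq_one : ∑ j ∈ s, y j = 1
  stationary : ∃ c, ∀ j ∈ s, 1 / √(y j) = η j * (G j + c)

theorem exists_isTsallisPoint {s : Finset ι} (hs : s.Nonempty) {η : ι → ℝ}
    (hη : ∀ j ∈ s, 0 < η j) (G : ι → ℝ) : ∃ y, IsTsallisPoint s η G y := by
  obtain ⟨i, his, hi⟩ := s.exists_min_image G hs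
  set a : ℝ := -G i + 1 / η i with ha
  set b : ℝ := a + ∑ j ∈ s, (s.card : ℝ) / η j with hb
  have hab : a ≤ b := by
    have : 0 ≤ ∑ j ∈ s, (s.card : ℝ) / η j :=
      Finset.sum_nonneg fun j hj => div_nonneg (Nat.cast_nonneg _) (hη j hj).le
    linarith
  have hηi : 0 < 1 / η i := one_div_pos.2 (hη i his)
  have hpos : ∀ j ∈ s, ∀ c, a ≤ c → 0 < η j * (G j + c) := fun j hj c hc =>
    mul_pos (hη j hj) (by have := hi j hj; linarith)
  set F : ℝ → ℝ := fun c => ∑ j ∈ s, ((η j * (G j + c)) ^ 2)⁻¹ with hF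
  have hcont : ContinuousOn F (Set.Icc a b) := by
    refine continuousOn_finsetSum _ fun j hj => ContinuousOn.inv₀ (by fun_prop) ?_
    intro c hc
    exact (pow_pos (hpos j hj c hc.1) 2).ne'
  have hFa : 1 ≤ F a := by
    have h1 : ((η i * (G i + a)) ^ 2)⁻¹ = 1 := by
      have : η i * (G i + a) = 1 := by
        rw [ha]; have := (hη i his).ne'; field_simp; ring
      rw [this]; norm_num
    calc (1 : ℝ) = ((η i * (G i + a)) ^ 2)⁻¹ := h1.symm
      _ ≤ F a := Finset.single_le_sum (f := fun j => ((η j * (G j + a)) ^ 2)⁻¹)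
          (fun j _ => by positivity) his
  have hcard : (1 : ℝ) ≤ s.card := by exact_mod_cast hs.card_pos
  have hFb : F b ≤ 1 := by
    have h1 : ∀ j ∈ s, ((η j * (G j + b)) ^ 2)⁻¹ ≤ (s.card : ℝ)⁻¹ := by
      intro j hj
      have h2 : (s.card : ℝ) / η j ≤ ∑ j ∈ s, (s.card : ℝ) / η j :=
        Finset.single_le_sum (f := fun j => (s.card : ℝ) / η j)
          (fun j hj => div_nonneg (Nat.cast_nonneg _) (hη j hj).le) hj
      have h3 : (s.card : ℝ) / η j ≤ G j + b := by
        have := hi j hj; linarith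
      have h4 : (s.card : ℝ) ≤ η j * (G j + b) := by
        rw [div_le_iff₀ (hη j hj)] at h3; linarith
      apply inv_anti₀ (by linarith)
      nlinarith
    calc F b ≤ ∑ j ∈ s, (s.card : ℝ)⁻¹ := Finset.sum_le_sum h1
      _ = 1 := by rw [Finset.sum_const, nsmul_eq_mul]; field_simp
  obtain ⟨c, hc, hFc⟩ := intermediate_value_Icc' hab hcont ⟨hFb, hFa⟩
  refine ⟨fun j => ((η j * (G j + c)) ^ 2)⁻¹, ?_, hFc, c, ?_⟩
  · intro j hj
    have := hpos j hj c hc.1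
    positivity
  · intro j hj
    rw [Real.sqrt_inv, Real.sqrt_sq (hpos j hj c hc.1).le, one_div, inv_inv]

/-- A chosen point as in `IsTsallisPoint`. -/
noncomputable def tsallisPoint (s : Finset ι) (η G : ι → ℝ) : ι → ℝ :=
  Classical.epsilon (IsTsallisPoint s η G)

theorem isTsallisPoint_tsallisPoint {s : Finset ι} (hs : s.Nonempty) {η : ι → ℝ}
    (hη : ∀ j ∈ s, 0 < η j) (G : ι → ℝ) : IsTsallisPoint s η G (tsallisPoint s η G) :=
  Classical.epsilon_spec (exists_isTsallisPoint hs hη G)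

/-- The objective of follow-the-regularized-leader with the Tsallis entropy. -/
noncomputable def tsallisObjective (s : Finset ι) (η G y : ι → ℝ) : ℝ :=
  ∑ j ∈ s, (y j * G j - 2 * √(y j) / η j)

theorem IsTsallisPoint.objective_eq {s : Finset ι} {η G y u : ι → ℝ} (hη : ∀ j ∈ s, 0 < η j)
    (hy : IsTsallisPoint s η G y) (hu : ∀ j ∈ s, 0 ≤ u j) (hu1 : ∑ j ∈ s, u j = 1) :
    tsallisObjective s η G u = tsallisObjective s η G y +
      ∑ j ∈ s, (√(u j) - √(y j)) ^ 2 / (η j * √(y j)) := by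
  obtain ⟨c, hc⟩ := hy.stationary
  have key : ∀ j ∈ s, u j * G j - 2 * √(u j) / η j =
      (y j * G j - 2 * √(y j) / η j) + (√(u j) - √(y j)) ^ 2 / (η j * √(y j))
        - c * (u j - y j) := by
    intro j hj
    have hsy : 0 < √(y j) := Real.sqrt_pos.2 (hy.pos j hj)
    have hG : G j = 1 / (η j * √(y j)) - c := by
      have := hc j hj
      have h := (hη j hj).ne'
      field_simp at this ⊢
      linarith
    have hu2 : u j = √(u j) ^ 2 := (Real.sq_sqrt (hu j hj)).symm
    have hy2 : y j = √(y j) ^ 2 := (Real.sq_sqrt (hy.pos j hj).le).symm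
    rw [hG]
    have h := (hη j hj).ne'
    generalize √(u j) = su at *
    generalize √(y j) = sy at *
    rw [hu2, hy2]
    field_simp
    ring
  have hz : ∑ j ∈ s, (u j - y j) = 0 := by
    rw [Finset.sum_sub_distrib, hu1, hy.sum_eq_one, sub_self]
  unfold tsallisObjective
  rw [Finset.sum_congr rfl key, Finset.sum_sub_distrib (f := fun j => _ + _), ← Finset.mul_sum,
    hz, Finset.sum_add_distrib]
  ring

theorem IsTsallisPoint.objective_le {s : Finset ι} {η G y : ι → ℝ} (hη : ∀ j ∈ s, 0 < η j)
    (hy : IsTsallisPoint s η G y) {i : ι} (hi : i ∈ s) : tsallisObjective s η G y ≤ G i := by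
  classical
  have h := hy.objective_eq hη (u := fun j => if j = i then 1 else 0)
    (fun j _ => by split_ifs <;> norm_num) (by simp [hi])
  have h1 : 0 ≤ ∑ j ∈ s, (√(if j = i then (1 : ℝ) else 0) - √(y j)) ^ 2 / (η j * √(y j)) :=
    Finset.sum_nonneg fun j hj =>
      div_nonneg (sq_nonneg _) (mul_nonneg (hη j hj).le (Real.sqrt_nonneg _))
  have h2 : tsallisObjective s η G (fun j => if j = i then (1 : ℝ) else 0) ≤ G i := by
    unfold tsallisObjective
    rw [Finset.sum_sub_distrib]
    have h3 : ∑ j ∈ s, (if j = i then (1 : ℝ) else 0) * G j = G i := by simp [hi]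
    have h4 : 0 ≤ ∑ j ∈ s, 2 * √(if j = i then (1 : ℝ) else 0) / η j :=
      Finset.sum_nonneg fun j hj => div_nonneg (by positivity) (hη j hj).le
    linarith
  linarith

theorem IsTsallisPoint.sum_mul_le {s : Finset ι} {η G L y y' : ι → ℝ} (hη : ∀ j ∈ s, 0 < η j)
    (hy : IsTsallisPoint s η G y) (hy' : IsTsallisPoint s η (fun j => G j + L j) y')
    (c : ℝ) (R : ι → ℝ)
    (hR : ∀ j ∈ s, (y j - y' j) * (L j - c) - (√(y' j) - √(y j)) ^ 2 / (η j * √(y j)) ≤ R j) :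
    ∑ j ∈ s, y j * L j ≤ tsallisObjective s η (fun j => G j + L j) y' - tsallisObjective s η G y
      + ∑ j ∈ s, R j := by
  have h1 := hy.objective_eq hη (fun j hj => (hy'.pos j hj).le) hy'.sum_eq_one
  have h2 : tsallisObjective s η (fun j => G j + L j) y' =
      tsallisObjective s η G y' + ∑ j ∈ s, y' j * L j := by
    unfold tsallisObjective
    rw [← Finset.sum_add_distrib]
    exact Finset.sum_congr rfl fun j _ => by ring
  have h3 := Finset.sum_le_sum hR
  have h4 : ∑ j ∈ s, ((y j - y' j) * (L j - c) - (√(y' j) - √(y j)) ^ 2 / (η j * √(y j))) =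
      ∑ j ∈ s, y j * L j - ∑ j ∈ s, y' j * L j - c * (∑ j ∈ s, y j - ∑ j ∈ s, y' j)
        - ∑ j ∈ s, (√(y' j) - √(y j)) ^ 2 / (η j * √(y j)) := by
    simp only [mul_sub, Finset.mul_sum, ← Finset.sum_sub_distrib]
    exact Finset.sum_congr rfl fun j _ => by ring
  rw [h4, hy.sum_eq_one, hy'.sum_eq_one] at h3
  linarith

theorem tsallis_stability {η y y' L c : ℝ} (hη : 0 < η) (hy : 0 < y) (hy' : 0 ≤ y') (hL : 0 ≤ L)
    (hc : 0 ≤ c) (hsmall : η * c * √y ≤ 1 / 2) :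
    (y - y') * (L - c) - (√y' - √y) ^ 2 / (η * √y) ≤ η * (y * √y) * (L ^ 2 + 2 * c ^ 2) := by
  have hu2 : y' = √y' ^ 2 := (Real.sq_sqrt hy').symm
  have hy2 : y = √y ^ 2 := (Real.sq_sqrt hy.le).symm
  have hv : 0 ≤ √y' := Real.sqrt_nonneg _
  have hw : 0 < √y := Real.sqrt_pos.2 hy
  generalize √y' = v at *
  generalize √y = w at *
  subst hu2 hy2
  have hηw : 0 < η * w := mul_pos hη hw
  rw [sub_le_iff_le_add, ← sub_le_iff_le_add', le_div_iff₀ hηw]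
  have hz : η * w * c ≤ 1 / 2 := by linarith
  set z := η * w with hzdef
  have goal' : ((w ^ 2 - v ^ 2) * (L - c) - z * w ^ 2 * (L ^ 2 + 2 * c ^ 2)) * z ≤ (v - w) ^ 2 := by
    rcases le_total c L with h | h
    · rcases le_total v w with h' | h'
      · have hd : 0 ≤ L - c := by linarith
        have e1 : (w ^ 2 - v ^ 2) * (L - c) * z ≤ 2 * w * (w - v) * (L - c) * z := by
          have : 0 ≤ (w - v) ^ 2 * ((L - c) * z) := by positivity
          nlinarith
        have e2 : (L - c) ^ 2 ≤ L ^ 2 + 2 * c ^ 2 := by nlinarith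
        have e3 : (z * w) ^ 2 * (L - c) ^ 2 ≤ (z * w) ^ 2 * (L ^ 2 + 2 * c ^ 2) :=
          mul_le_mul_of_nonneg_left e2 (sq_nonneg _)
        nlinarith [sq_nonneg ((w - v) - z * w * (L - c))]
      · have e1 : (w ^ 2 - v ^ 2) * (L - c) * z ≤ 0 := by
          have : 0 ≤ (v - w) * (v + w) * ((L - c) * z) :=
            mul_nonneg (mul_nonneg (by linarith) (by linarith)) (mul_nonneg (by linarith) hηw.le)
          nlinarith
        have e2 : 0 ≤ z * w ^ 2 * (L ^ 2 + 2 * c ^ 2) * z := by positivity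
        nlinarith [sq_nonneg (v - w)]
    · rcases le_total v w with h' | h'
      · have e1 : (w ^ 2 - v ^ 2) * (L - c) * z ≤ 0 := by
          have : 0 ≤ (w - v) * (v + w) * ((c - L) * z) :=
            mul_nonneg (mul_nonneg (by linarith) (by linarith)) (mul_nonneg (by linarith) hηw.le)
          nlinarith
        have e2 : 0 ≤ z * w ^ 2 * (L ^ 2 + 2 * c ^ 2) * z := by positivity
        nlinarith [sq_nonneg (v - w)]
      · have e0 : (w ^ 2 - v ^ 2) * (L - c) * z ≤ (v ^ 2 - w ^ 2) * c * z := by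
          have : 0 ≤ (v - w) * (v + w) * (L * z) :=
            mul_nonneg (mul_nonneg (by linarith) (by linarith)) (mul_nonneg hL hηw.le)
          nlinarith
        have e1 : (v - w) ^ 2 * (z * c) ≤ (v - w) ^ 2 * (1 / 2) :=
          mul_le_mul_of_nonneg_left hz (sq_nonneg _)
        have e2 : 0 ≤ z * w ^ 2 * L ^ 2 * z := by positivity
        nlinarith [sq_nonneg ((v - w) - 2 * (z * w * c))]
  have e : η * (w ^ 2 * w) * (L ^ 2 + 2 * c ^ 2) = z * w ^ 2 * (L ^ 2 + 2 * c ^ 2) := by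
    rw [hzdef]; ring
  rw [e]
  exact goal'

end Tsallis

section Game

variable {V : Type}

theorem hist_append_singleton (E : V → V → Bool) (ℓ : ℕ → V → ℝ) (l : List V) (a : V) :
    hist E ℓ (l ++ [a]) = hist E ℓ l ++ [(a, feedbackOf E (ℓ l.length) a)] := by
  unfold hist
  rw [List.length_append, List.length_singleton, List.range_succ,
    List.zipWith_append (by simp)]
  rfl

theorem ofFn_snoc {T : ℕ} (as : Fin T → V) (a : V) :
    List.ofFn (Fin.snoc as a : Fin (T + 1) → V) = List.ofFn as ++ [a] := by
  rw [List.ofFn_succ']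
  simp [List.concat_eq_append]

variable [Fintype V]

theorem seqProb_snoc (π : Policy V) (E : V → V → Bool) (ℓ : ℕ → V → ℝ) {T : ℕ} (as : Fin T → V)
    (a : V) : seqProb π E ℓ (T + 1) (Fin.snoc as a) =
      seqProb π E ℓ T as * (π (hist E ℓ (List.ofFn as)) a).toReal := by
  unfold seqProb
  rw [Fin.prod_univ_castSucc, ofFn_snoc]
  congr 1
  · refine Finset.prod_congr rfl fun t _ => ?_
    rw [Fin.snoc_castSucc, List.take_append_of_le_length (by simp [t.2.le])]
    rfl
  · rw [Fin.snoc_last, List.take_append_of_le_length (by simp), List.take_of_length_le (by simp)]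

theorem sum_fin_succ_fun {T : ℕ} (F : (Fin (T + 1) → V) → ℝ) :
    ∑ as, F as = ∑ as : Fin T → V, ∑ a, F (Fin.snoc as a) := by
  rw [← (Fin.snocEquiv fun _ : Fin (T + 1) => V).sum_comp, Fintype.sum_prod_type,
    Finset.sum_comm]
  rfl

theorem sum_pmf_toReal (μ : PMF V) : ∑ a, (μ a).toReal = 1 := by
  rw [← ENNReal.toReal_sum fun a _ => μ.apply_ne_top a]
  have : ∑ a, μ a = 1 := by rw [← μ.tsum_coe, tsum_fintype]
  rw [this, ENNReal.toReal_one]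

theorem exists_pmf {p : V → ℝ} (h0 : ∀ v, 0 ≤ p v) (h1 : ∑ v, p v = 1) :
    ∃ μ : PMF V, ∀ v, (μ v).toReal = p v := by
  refine ⟨PMF.ofFintype (fun v => ENNReal.ofReal (p v)) ?_, fun v => ?_⟩
  · rw [← ENNReal.ofReal_sum_of_nonneg fun v _ => h0 v, h1, ENNReal.ofReal_one]
  · rw [PMF.ofFintype_apply, ENNReal.toReal_ofReal (h0 v)]

theorem sum_seqProb (π : Policy V) (E : V → V → Bool) (ℓ : ℕ → V → ℝ) (T : ℕ) :
    ∑ as, seqProb π E ℓ T as = 1 := by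
  induction T with
  | zero => simp [seqProb]
  | succ T ih =>
    rw [sum_fin_succ_fun, ← ih]
    refine Finset.sum_congr rfl fun as _ => ?_
    simp_rw [seqProb_snoc]
    rw [← Finset.mul_sum, sum_pmf_toReal, mul_one]

theorem seqProb_nonneg (π : Policy V) (E : V → V → Bool) (ℓ : ℕ → V → ℝ) (T : ℕ)
    (as : Fin T → V) : 0 ≤ seqProb π E ℓ T as :=
  Finset.prod_nonneg fun _ _ => ENNReal.toReal_nonneg

/-- A nonnegative potential of the history whose expected increase, together with the loss of the
round, is at most `c t`, controls the expected cumulative loss. -/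
theorem expectedLoss_le_of_potential (π : Policy V) (E : V → V → Bool) (ℓ : ℕ → V → ℝ)
    (W : List (V × (V → Option ℝ)) → ℝ) (c : ℕ → ℝ) (hW : ∀ h, 0 ≤ W h)
    (hstep : ∀ t h, ∑ a, (π h a).toReal * (ℓ t a + W (h ++ [(a, feedbackOf E (ℓ t) a)])) ≤
      W h + c t) (T : ℕ) :
    expectedLoss π E ℓ T ≤ W [] + ∑ t : Fin T, c t := by
  have main : ∑ as : Fin T → V, seqProb π E ℓ T as *
      (∑ t : Fin T, ℓ t (as t) + W (hist E ℓ (List.ofFn as))) ≤ W [] + ∑ t : Fin T, c t := by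
    induction T with
    | zero => simp [seqProb, hist]
    | succ T ih =>
      rw [sum_fin_succ_fun, Fin.sum_univ_castSucc, ← add_assoc]
      have h1 : ∀ as : Fin T → V, ∑ a, seqProb π E ℓ (T + 1) (Fin.snoc as a) *
          (∑ t : Fin (T + 1), ℓ t ((Fin.snoc as a : Fin (T + 1) → V) t) +
            W (hist E ℓ (List.ofFn (Fin.snoc as a : Fin (T + 1) → V)))) ≤
          seqProb π E ℓ T as * (∑ t : Fin T, ℓ t (as t) + W (hist E ℓ (List.ofFn as))) +
            seqProb π E ℓ T as * c T := by
        intro as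
        have h2 := hstep T (hist E ℓ (List.ofFn as))
        have h3 := sum_pmf_toReal (π (hist E ℓ (List.ofFn as)))
        calc _ = seqProb π E ℓ T as * (∑ t : Fin T, ℓ t (as t) *
              ∑ a, (π (hist E ℓ (List.ofFn as)) a).toReal + 
              ∑ a, (π (hist E ℓ (List.ofFn as)) a).toReal * (ℓ T a +
                W (hist E ℓ (List.ofFn as) ++ [(a, feedbackOf E (ℓ T) a)]))) := by
              rw [← Finset.sum_mul, Finset.mul_sum, ← Finset.sum_add_distrib, Finset.mul_sum]
              refine Finset.sum_congr rfl fun a _ => ?_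
              rw [seqProb_snoc, Fin.sum_univ_castSucc, ofFn_snoc, hist_append_singleton]
              simp only [Fin.snoc_castSucc, Fin.snoc_last, List.length_ofFn, Fin.val_castSucc,
                Fin.val_last]
              ring
          _ ≤ _ := by
              rw [← mul_add, h3]
              refine mul_le_mul_of_nonneg_left ?_ (seqProb_nonneg _ _ _ _ _)
              simp only [mul_one]
              linarith
      calc _ ≤ _ := Finset.sum_le_sum fun as _ => h1 as
        _ ≤ _ := by
          rw [Finset.sum_add_distrib, ← Finset.sum_mul, sum_seqProb, one_mul]
          simpa using ih
  refine le_trans (Finset.sum_le_sum fun as _ => ?_) main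
  exact mul_le_mul_of_nonneg_left (by linarith [hW (hist E ℓ (List.ofFn as))])
    (seqProb_nonneg _ _ _ _ _)

end Game

section Scheme

variable {V : Type} [Fintype V] [DecidableEq V] {E : V → V → Bool} {m : ℕ}

/-- The parameters of a two-level strategy on a partition of the vertices into blocks: weak blocks
come with a fractional dominating vector `dom` of mass `δ` and a choice `nbr` of in-neighbors; the
other blocks consist of one strongly observable vertex. -/
structure BlockScheme (V : Type) [Fintype V] [DecidableEq V] (E : V → V → Bool) (m : ℕ) where
  /-- the block of a vertex -/
  blk : V → Fin m
  /-- the blocks that need exploration -/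
  weak : Finset (Fin m)
  /-- a fractional dominating vector of each weak block -/
  dom : V → ℝ
  /-- an in-neighbor of each vertex of a weak block -/
  nbr : V → V
  /-- the mass of the dominating vector -/
  δ : Fin m → ℝ
  /-- the scale of the exploration for the choice of the block -/
  α : ℝ
  /-- the rate of the exploration for the choice inside a block -/
  ε : Fin m → ℝ
  /-- the learning rate of the weak blocks -/
  η : ℝ
  /-- the learning rate of the other blocks -/
  ηs : ℝ
  /-- the learning rates inside the blocks -/
  ηin : Fin m → ℝ
  blk_surj : ∀ k, ∃ v, blk v = k
  eq_of_blk_eq : ∀ v, blk v ∉ weak → ∀ u, blk u = blk v → u = v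
  strong : ∀ v, blk v ∉ weak → StronglyObservableVertex E v
  weak_nonempty : weak.Nonempty
  dom_nonneg : ∀ v, blk v ∈ weak → 0 ≤ dom v
  dom_sum : ∀ k ∈ weak, ∑ v with blk v = k, dom v = δ k
  dom_cover : ∀ u, blk u ∈ weak → 1 ≤ ∑ v with blk v = blk u ∧ E v u, dom v
  blk_nbr : ∀ v, blk v ∈ weak → blk (nbr v) = blk v
  nbr_edge : ∀ v, blk v ∈ weak → E (nbr v) v
  δ_pos : ∀ k ∈ weak, 0 < δ k
  α_pos : 0 < α
  ε_pos : ∀ k ∈ weak, 0 < ε k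
  η_pos : 0 < η
  η_le : η ≤ ηs
  ηin_pos : ∀ k, 0 < ηin k
  budget_le : α * √(∑ k ∈ weak, δ k ^ 2) + ∑ k ∈ weak, ε k ≤ 1 / 2
  ηs_le : ηs ≤ (∑ k ∈ weak, ε k) / 2

namespace BlockScheme

variable (S : BlockScheme V E m)

/-- Admissible weights: a distribution inside each block and a distribution over blocks. -/
structure IsWeights (x : V → ℝ) (Y : Fin m → ℝ) : Prop where
  x_pos : ∀ v, 0 < x v
  x_sum : ∀ k, ∑ v with S.blk v = k, x v = 1
  Y_pos : ∀ k, 0 < Y k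
  Y_sum : ∑ k, Y k = 1

/-- The rate at which each vertex of a weak block is observed by exploration. -/
noncomputable def rate (Y : Fin m → ℝ) (k : Fin m) : ℝ := S.α * √(Y k) + S.ε k / (2 * S.δ k)

/-- The exploration along the dominating vectors. -/
noncomputable def exploreDom (Y : Fin m → ℝ) (v : V) : ℝ :=
  if S.blk v ∈ S.weak then S.rate Y (S.blk v) * S.dom v else 0

/-- The exploration of chosen in-neighbors. -/
noncomputable def exploreNbr (x : V → ℝ) (v : V) : ℝ :=
  ∑ i with S.blk i ∈ S.weak ∧ S.nbr i = v, S.ε (S.blk i) / 2 * x i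

/-- The total exploration. -/
noncomputable def totalExplore (Y : Fin m → ℝ) : ℝ :=
  ∑ k ∈ S.weak, (S.α * √(Y k) * S.δ k + S.ε k)

/-- The sampling distribution. -/
noncomputable def sampling (x : V → ℝ) (Y : Fin m → ℝ) (v : V) : ℝ :=
  (1 - S.totalExplore Y) * (Y (S.blk v) * x v) + (S.exploreDom Y v + S.exploreNbr x v)

/-- The probability that the loss of a vertex is observed. -/
noncomputable def obs (x : V → ℝ) (Y : Fin m → ℝ) (i : V) : ℝ :=
  ∑ a with E a i, S.sampling x Y a

variable {S} {x : V → ℝ} {Y : Fin m → ℝ}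

theorem sum_eq_sum_blk (F : V → ℝ) : ∑ v, F v = ∑ k, ∑ v with S.blk v = k, F v :=
  (Finset.sum_fiberwise _ _ _).symm

theorem sum_weak_eq (F : V → ℝ) : ∑ v, (if S.blk v ∈ S.weak then F v else 0) =
    ∑ k ∈ S.weak, ∑ v with S.blk v = k, F v := by
  rw [sum_eq_sum_blk (S := S), ← Finset.sum_subset (Finset.subset_univ S.weak)]
  · refine Finset.sum_congr rfl fun k hk => Finset.sum_congr rfl fun v hv => ?_
    rw [Finset.mem_filter] at hv
    rw [if_pos (hv.2 ▸ hk)]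
  · intro k _ hk
    refine Finset.sum_eq_zero fun v hv => ?_
    rw [Finset.mem_filter] at hv
    rw [if_neg (hv.2 ▸ hk)]

theorem sum_single {v : V} (hv : S.blk v ∉ S.weak) (F : V → ℝ) :
    ∑ u with S.blk u = S.blk v, F u = F v := by
  rw [Finset.sum_eq_single v]
  · intro u hu hne
    exact absurd (S.eq_of_blk_eq v hv u (Finset.mem_filter.1 hu).2) hne
  · intro h
    simp at h

theorem sum_blk_mul (F : Fin m → ℝ) (f : V → ℝ) (k : Fin m) :
    ∑ v with S.blk v = k, F (S.blk v) * f v = F k * ∑ v with S.blk v = k, f v := by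
  rw [Finset.mul_sum]
  refine Finset.sum_congr rfl fun v hv => ?_
  rw [(Finset.mem_filter.1 hv).2]

theorem IsWeights.x_single (h : S.IsWeights x Y) {v : V} (hv : S.blk v ∉ S.weak) : x v = 1 := by
  rw [← sum_single hv x, h.x_sum]

theorem IsWeights.Y_le_one (h : S.IsWeights x Y) (k : Fin m) : Y k ≤ 1 := by
  rw [← h.Y_sum]
  exact Finset.single_le_sum (fun k _ => (h.Y_pos k).le) (Finset.mem_univ k)

theorem rate_pos {k : Fin m} (hk : k ∈ S.weak) (hY : 0 < Y k) : 0 < S.rate Y k := by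
  have h1 := mul_pos S.α_pos (Real.sqrt_pos.2 hY)
  have h2 := div_pos (S.ε_pos k hk) (mul_pos two_pos (S.δ_pos k hk))
  unfold rate
  linarith

theorem exploreDom_nonneg (h : S.IsWeights x Y) (v : V) : 0 ≤ S.exploreDom Y v := by
  unfold exploreDom
  split_ifs with hv
  · exact mul_nonneg (rate_pos hv (h.Y_pos _)).le (S.dom_nonneg v hv)
  · exact le_rfl

theorem exploreNbr_nonneg (h : S.IsWeights x Y) (v : V) : 0 ≤ S.exploreNbr x v := by
  refine Finset.sum_nonneg fun i hi => ?_
  have := S.ε_pos _ (Finset.mem_filter.1 hi).2.1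
  have := h.x_pos i
  positivity

theorem sum_explore (h : S.IsWeights x Y) :
    ∑ v, (S.exploreDom Y v + S.exploreNbr x v) = S.totalExplore Y := by
  have h1 : ∑ v, S.exploreDom Y v = ∑ k ∈ S.weak, (S.α * √(Y k) * S.δ k + S.ε k / 2) := by
    unfold exploreDom
    rw [sum_weak_eq]
    refine Finset.sum_congr rfl fun k hk => ?_
    rw [sum_blk_mul (S.rate Y), S.dom_sum k hk, rate]
    have := (S.δ_pos k hk).ne'
    field_simp
  have h2 : ∑ v, S.exploreNbr x v = ∑ k ∈ S.weak, S.ε k / 2 := by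
    have : ∀ v, S.exploreNbr x v = ∑ i ∈ Finset.univ.filter (fun i => S.blk i ∈ S.weak) with
        S.nbr i = v, S.ε (S.blk i) / 2 * x i := fun v => by
      rw [exploreNbr, Finset.filter_filter]
    simp_rw [this]
    rw [Finset.sum_fiberwise, Finset.sum_filter, sum_weak_eq]
    refine Finset.sum_congr rfl fun k hk => ?_
    rw [sum_blk_mul (fun k => S.ε k / 2), h.x_sum, mul_one]
  rw [Finset.sum_add_distrib, h1, h2, ← Finset.sum_add_distrib]
  refine Finset.sum_congr rfl fun k _ => by ring

theorem totalExplore_le (h : S.IsWeights x Y) :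
    S.totalExplore Y ≤ S.α * √(∑ k ∈ S.weak, S.δ k ^ 2) + ∑ k ∈ S.weak, S.ε k := by
  have h1 : ∑ k ∈ S.weak, √(Y k) * S.δ k ≤ √(∑ k ∈ S.weak, S.δ k ^ 2) := by
    refine (Real.sum_mul_le_sqrt_mul_sqrt _ _ _).trans ?_
    have h2 : ∑ k ∈ S.weak, √(Y k) ^ 2 ≤ 1 := by
      rw [← h.Y_sum]
      refine (Finset.sum_le_sum_of_subset_of_nonneg (Finset.subset_univ S.weak)
        fun k _ _ => sq_nonneg _).trans_eq ?_
      exact Finset.sum_congr rfl fun k _ => Real.sq_sqrt (h.Y_pos k).le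
    exact mul_le_of_le_one_left (Real.sqrt_nonneg _) (Real.sqrt_le_one.2 h2)
  have h3 := mul_le_mul_of_nonneg_left h1 S.α_pos.le
  unfold totalExplore
  rw [Finset.sum_add_distrib]
  simp_rw [mul_assoc]
  rw [← Finset.mul_sum]
  linarith

theorem totalExplore_le_half (h : S.IsWeights x Y) : S.totalExplore Y ≤ 1 / 2 :=
  (totalExplore_le h).trans S.budget_le

theorem sum_ε_pos (S : BlockScheme V E m) : 0 < ∑ k ∈ S.weak, S.ε k :=
  Finset.sum_pos S.ε_pos S.weak_nonempty

theorem sum_ε_le_totalExplore (S : BlockScheme V E m) (Y : Fin m → ℝ) :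
    ∑ k ∈ S.weak, S.ε k ≤ S.totalExplore Y := by
  refine Finset.sum_le_sum fun k hk => ?_
  have := mul_nonneg (mul_nonneg S.α_pos.le (Real.sqrt_nonneg (Y k))) (S.δ_pos k hk).le
  linarith

theorem sampling_nonneg (h : S.IsWeights x Y) (v : V) : 0 ≤ S.sampling x Y v := by
  have h1 := totalExplore_le_half h
  have h2 := mul_pos (h.Y_pos (S.blk v)) (h.x_pos v)
  have h3 : 0 ≤ (1 - S.totalExplore Y) * (Y (S.blk v) * x v) :=
    mul_nonneg (by linarith) h2.le
  have := exploreDom_nonneg h v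
  have := exploreNbr_nonneg h v
  unfold sampling
  linarith

theorem sum_weights (h : S.IsWeights x Y) : ∑ v, Y (S.blk v) * x v = 1 := by
  rw [sum_eq_sum_blk (S := S), ← h.Y_sum]
  refine Finset.sum_congr rfl fun k _ => ?_
  rw [sum_blk_mul Y, h.x_sum, mul_one]

theorem sum_sampling (h : S.IsWeights x Y) : ∑ v, S.sampling x Y v = 1 := by
  unfold sampling
  rw [Finset.sum_add_distrib, ← Finset.mul_sum, sum_weights h, sum_explore h]
  ring

theorem sum_sampling_mul_le (h : S.IsWeights x Y) {l : V → ℝ} (hl : ∀ v, 0 ≤ l v ∧ l v ≤ 1) :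
    ∑ v, S.sampling x Y v * l v ≤ ∑ v, Y (S.blk v) * x v * l v +
      (S.α * √(∑ k ∈ S.weak, S.δ k ^ 2) + ∑ k ∈ S.weak, S.ε k) := by
  have h0 := totalExplore_le h
  have h1 : 0 ≤ S.totalExplore Y := (sum_ε_pos S).le.trans (sum_ε_le_totalExplore S Y)
  have h2 : ∀ v, S.sampling x Y v * l v ≤ Y (S.blk v) * x v * l v +
      (S.exploreDom Y v + S.exploreNbr x v) := by
    intro v
    have e1 := mul_pos (h.Y_pos (S.blk v)) (h.x_pos v)
    have e2 := exploreDom_nonneg h v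
    have e3 := exploreNbr_nonneg h v
    obtain ⟨l0, l1⟩ := hl v
    have e4 : 0 ≤ S.totalExplore Y * (Y (S.blk v) * x v * l v) :=
      mul_nonneg h1 (mul_nonneg e1.le l0)
    have e5 : (S.exploreDom Y v + S.exploreNbr x v) * l v ≤
        S.exploreDom Y v + S.exploreNbr x v := mul_le_of_le_one_right (by linarith) l1
    unfold sampling
    linarith
  calc _ ≤ _ := Finset.sum_le_sum fun v _ => h2 v
    _ ≤ _ := by
      rw [Finset.sum_add_distrib, sum_explore h]
      linarith

theorem explore_le_obs (h : S.IsWeights x Y) {i : V} (hi : S.blk i ∈ S.weak) :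
    S.rate Y (S.blk i) + S.ε (S.blk i) / 2 * x i ≤ S.obs x Y i := by
  have h1 : ∀ a, S.exploreDom Y a + S.exploreNbr x a ≤ S.sampling x Y a := by
    intro a
    have := mul_nonneg (sub_nonneg.2 ((totalExplore_le_half h).trans one_half_lt_one.le))
      (mul_pos (h.Y_pos (S.blk a)) (h.x_pos a)).le
    unfold sampling
    linarith
  have h2 : S.rate Y (S.blk i) ≤ ∑ a with E a i, S.exploreDom Y a := by
    have e1 : S.rate Y (S.blk i) ≤
        ∑ a with S.blk a = S.blk i ∧ E a i, S.rate Y (S.blk i) * S.dom a := by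
      rw [← Finset.mul_sum]
      exact le_mul_of_one_le_right (rate_pos hi (h.Y_pos _)).le (S.dom_cover i hi)
    refine e1.trans (le_trans (Finset.sum_le_sum fun a ha => ?_)
      (Finset.sum_le_sum_of_subset_of_nonneg (s := Finset.univ.filter fun a =>
        S.blk a = S.blk i ∧ E a i) ?_ fun a _ _ => exploreDom_nonneg h a))
    · have := (Finset.mem_filter.1 ha).2.1
      rw [exploreDom, if_pos (this ▸ hi), this]
    · intro a ha
      simp only [Finset.mem_filter] at ha ⊢
      exact ⟨ha.1, ha.2.2⟩
  have h3 : S.ε (S.blk i) / 2 * x i ≤ ∑ a with E a i, S.exploreNbr x a := by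
    refine le_trans ?_ (Finset.single_le_sum (f := S.exploreNbr x)
      (fun a _ => exploreNbr_nonneg h a)
      (Finset.mem_filter.2 ⟨Finset.mem_univ (S.nbr i), S.nbr_edge i hi⟩))
    refine Finset.single_le_sum (f := fun i => S.ε (S.blk i) / 2 * x i) (fun j hj => ?_)
      (Finset.mem_filter.2 ⟨Finset.mem_univ i, hi, rfl⟩)
    have := S.ε_pos _ (Finset.mem_filter.1 hj).2.1
    have := h.x_pos j
    positivity
  calc _ ≤ ∑ a with E a i, (S.exploreDom Y a + S.exploreNbr x a) := by
        rw [Finset.sum_add_distrib]; linarith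
    _ ≤ _ := Finset.sum_le_sum fun a _ => h1 a

theorem half_le_obs (h : S.IsWeights x Y) {i : V} (hi : S.blk i ∉ S.weak) (hE : E i i) :
    Y (S.blk i) / 2 ≤ S.obs x Y i := by
  have h1 : S.sampling x Y i ≤ S.obs x Y i :=
    Finset.single_le_sum (f := S.sampling x Y) (fun a _ => sampling_nonneg h a)
      (Finset.mem_filter.2 ⟨Finset.mem_univ i, hE⟩)
  have h2 := totalExplore_le_half h
  have h3 := exploreDom_nonneg h i
  have h4 := exploreNbr_nonneg h i
  have h5 := h.Y_pos (S.blk i)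
  unfold sampling at h1
  rw [h.x_single hi] at h1
  nlinarith

theorem obs_eq_of_not_loop (h : S.IsWeights x Y) {i : V} (hi : S.blk i ∉ S.weak) (hE : ¬ E i i) :
    S.obs x Y i = 1 - (1 - S.totalExplore Y) * Y (S.blk i) := by
  have hall : ∀ u, u ≠ i → E u i := (S.strong i hi).resolve_left hE
  have h1 : S.obs x Y i = 1 - S.sampling x Y i := by
    rw [← sum_sampling h, eq_sub_iff_add_eq, ← Finset.sum_erase_add _ _ (Finset.mem_univ i), obs]
    congr 1
    refine Finset.sum_congr ?_ fun _ _ => rfl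
    ext a
    simp only [Finset.mem_filter, Finset.mem_univ, true_and, Finset.mem_erase, and_true]
    exact ⟨fun ha hai => hE (hai ▸ ha), hall a⟩
  have h2 : S.exploreNbr x i = 0 := by
    refine Finset.sum_eq_zero fun j hj => ?_
    obtain ⟨hj1, hj2⟩ := (Finset.mem_filter.1 hj).2
    exact absurd (hj2 ▸ (S.blk_nbr j hj1).symm ▸ hj1) hi
  rw [h1, sampling, h2, exploreDom, if_neg hi, h.x_single hi]
  ring

theorem one_sub_le_obs (h : S.IsWeights x Y) {i : V} (hi : S.blk i ∉ S.weak) (hE : ¬ E i i) :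
    1 - Y (S.blk i) ≤ S.obs x Y i := by
  rw [obs_eq_of_not_loop h hi hE]
  have := mul_nonneg ((sum_ε_pos S).le.trans (sum_ε_le_totalExplore S Y)) (h.Y_pos (S.blk i)).le
  linarith

theorem sum_ε_le_obs (h : S.IsWeights x Y) {i : V} (hi : S.blk i ∉ S.weak) (hE : ¬ E i i) :
    ∑ k ∈ S.weak, S.ε k ≤ S.obs x Y i := by
  rw [obs_eq_of_not_loop h hi hE]
  have h1 := totalExplore_le_half h
  have h2 := mul_le_mul_of_nonneg_left (h.Y_le_one (S.blk i))
    (show 0 ≤ 1 - S.totalExplore Y by linarith)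
  have h3 := sum_ε_le_totalExplore S Y
  linarith

theorem obs_pos (h : S.IsWeights x Y) (i : V) : 0 < S.obs x Y i := by
  by_cases hi : S.blk i ∈ S.weak
  · have h1 := explore_le_obs h hi
    have h2 := rate_pos hi (h.Y_pos _)
    have h3 := mul_pos (half_pos (S.ε_pos _ hi)) (h.x_pos i)
    linarith
  · by_cases hE : E i i
    · have := half_le_obs h hi hE
      have := h.Y_pos (S.blk i)
      linarith
    · exact (sum_ε_pos S).trans_le (sum_ε_le_obs h hi hE)

/-- The importance-weighted loss estimate of vertex `i` when `a` is played. -/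
noncomputable def lossEst (S : BlockScheme V E m) (x : V → ℝ) (Y : Fin m → ℝ) (l : V → ℝ)
    (a i : V) : ℝ :=
  if E a i then l i / S.obs x Y i else 0

/-- The estimate of the loss of a block. -/
noncomputable def blockEst (S : BlockScheme V E m) (x : V → ℝ) (Y : Fin m → ℝ) (l : V → ℝ)
    (a : V) (k : Fin m) : ℝ :=
  ∑ i with S.blk i = k, x i * S.lossEst x Y l a i

theorem lossEst_nonneg (h : S.IsWeights x Y) {l : V → ℝ} (hl : ∀ v, 0 ≤ l v ∧ l v ≤ 1) (a i : V) :
    0 ≤ S.lossEst x Y l a i := by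
  unfold lossEst
  split_ifs
  · exact div_nonneg (hl i).1 (obs_pos h i).le
  · exact le_rfl

theorem lossEst_le (h : S.IsWeights x Y) {l : V → ℝ} (hl : ∀ v, 0 ≤ l v ∧ l v ≤ 1) (a i : V) :
    S.lossEst x Y l a i ≤ 1 / S.obs x Y i := by
  have := obs_pos h i
  unfold lossEst
  split_ifs
  · exact div_le_div_of_nonneg_right (hl i).2 this.le
  · positivity

theorem sum_sampling_lossEst (h : S.IsWeights x Y) (l : V → ℝ) (i : V) :
    ∑ a, S.sampling x Y a * S.lossEst x Y l a i = l i := by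
  have := (obs_pos h i).ne'
  calc _ = ∑ a with E a i, S.sampling x Y a * (l i / S.obs x Y i) := by
        rw [Finset.sum_filter]
        refine Finset.sum_congr rfl fun a _ => ?_
        unfold lossEst
        split_ifs <;> simp
    _ = S.obs x Y i * (l i / S.obs x Y i) := by rw [← Finset.sum_mul]; rfl
    _ = l i := by field_simp

theorem sum_sampling_lossEst_sq_le (h : S.IsWeights x Y) {l : V → ℝ}
    (hl : ∀ v, 0 ≤ l v ∧ l v ≤ 1) (i : V) :
    ∑ a, S.sampling x Y a * S.lossEst x Y l a i ^ 2 ≤ 1 / S.obs x Y i := by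
  have hq := obs_pos h i
  calc _ ≤ ∑ a, S.sampling x Y a * S.lossEst x Y l a i * (1 / S.obs x Y i) := by
        refine Finset.sum_le_sum fun a _ => ?_
        rw [sq, ← mul_assoc]
        exact mul_le_mul_of_nonneg_left (lossEst_le h hl a i)
          (mul_nonneg (sampling_nonneg h a) (lossEst_nonneg h hl a i))
    _ = l i * (1 / S.obs x Y i) := by rw [← Finset.sum_mul, sum_sampling_lossEst h]
    _ ≤ _ := mul_le_of_le_one_left (by positivity) (hl i).2

theorem blockEst_nonneg (h : S.IsWeights x Y) {l : V → ℝ} (hl : ∀ v, 0 ≤ l v ∧ l v ≤ 1) (a : V)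
    (k : Fin m) : 0 ≤ S.blockEst x Y l a k :=
  Finset.sum_nonneg fun i _ => mul_nonneg (h.x_pos i).le (lossEst_nonneg h hl a i)

theorem blockEst_single (h : S.IsWeights x Y) {i : V} (hi : S.blk i ∉ S.weak) (l : V → ℝ) (a : V) :
    S.blockEst x Y l a (S.blk i) = S.lossEst x Y l a i := by
  rw [blockEst, sum_single hi (fun i => x i * S.lossEst x Y l a i), h.x_single hi, one_mul]

theorem sum_sampling_blockEst (h : S.IsWeights x Y) (l : V → ℝ) (k : Fin m) :
    ∑ a, S.sampling x Y a * S.blockEst x Y l a k = ∑ i with S.blk i = k, x i * l i := by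
  unfold blockEst
  simp_rw [Finset.mul_sum]
  rw [Finset.sum_comm]
  refine Finset.sum_congr rfl fun i _ => ?_
  rw [← sum_sampling_lossEst h l i, Finset.mul_sum]
  exact Finset.sum_congr rfl fun a _ => by ring

theorem sum_sampling_blockEst_sq_le (h : S.IsWeights x Y) {l : V → ℝ}
    (hl : ∀ v, 0 ≤ l v ∧ l v ≤ 1) (k : Fin m) :
    ∑ a, S.sampling x Y a * S.blockEst x Y l a k ^ 2 ≤
      ∑ i with S.blk i = k, x i / S.obs x Y i := by
  have h1 : ∀ a, S.blockEst x Y l a k ^ 2 ≤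
      ∑ i with S.blk i = k, x i * S.lossEst x Y l a i ^ 2 := by
    intro a
    have := Finset.sum_sq_le_sum_mul_sum_of_sq_le_mul (Finset.univ.filter fun i => S.blk i = k)
      (r := fun i => x i * S.lossEst x Y l a i) (f := x)
      (g := fun i => x i * S.lossEst x Y l a i ^ 2) (fun i _ => (h.x_pos i).le)
      (fun i _ => mul_nonneg (h.x_pos i).le (sq_nonneg _)) (fun i _ => le_of_eq (by ring))
    rwa [h.x_sum, one_mul] at this
  calc _ ≤ ∑ a, S.sampling x Y a * ∑ i with S.blk i = k, x i * S.lossEst x Y l a i ^ 2 :=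
        Finset.sum_le_sum fun a _ => mul_le_mul_of_nonneg_left (h1 a) (sampling_nonneg h a)
    _ = ∑ i with S.blk i = k, x i * ∑ a, S.sampling x Y a * S.lossEst x Y l a i ^ 2 := by
        simp_rw [Finset.mul_sum]
        rw [Finset.sum_comm]
        exact Finset.sum_congr rfl fun i _ => Finset.sum_congr rfl fun a _ => by ring
    _ ≤ _ := by
        refine Finset.sum_le_sum fun i _ => ?_
        rw [div_eq_mul_one_div]
        exact mul_le_mul_of_nonneg_left (sum_sampling_lossEst_sq_le h hl i) (h.x_pos i).le

theorem sum_inner_stability_le (h : S.IsWeights x Y) {l : V → ℝ} (hl : ∀ v, 0 ≤ l v ∧ l v ≤ 1)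
    {k : Fin m} (hk : k ∈ S.weak) :
    ∑ a, S.sampling x Y a *
      ∑ i with S.blk i = k, S.ηin k * (x i * √(x i)) * S.lossEst x Y l a i ^ 2 ≤
      S.ηin k * √(S.δ k) / S.ε k := by
  have hη := S.ηin_pos k
  have hε := S.ε_pos k hk
  have hδ := S.δ_pos k hk
  have h1 : ∀ i, S.blk i = k → √(x i) * (1 / S.obs x Y i) ≤ √(S.δ k) / S.ε k := by
    rintro i rfl
    have hobs := explore_le_obs h hk
    have hr : S.ε (S.blk i) / (2 * S.δ (S.blk i)) ≤ S.rate Y (S.blk i) :=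
      le_add_of_nonneg_left (mul_nonneg S.α_pos.le (Real.sqrt_nonneg _))
    rw [mul_one_div, div_le_div_iff₀ (obs_pos h i) hε]
    have hs : 0 < √(S.δ (S.blk i)) := Real.sqrt_pos.2 hδ
    have hs2 : √(S.δ (S.blk i)) ^ 2 = S.δ (S.blk i) := Real.sq_sqrt hδ.le
    have hw2 : √(x i) ^ 2 = x i := Real.sq_sqrt (h.x_pos i).le
    refine le_trans ?_ (mul_le_mul_of_nonneg_left
      ((add_le_add_left hr _).trans hobs) hs.le)
    generalize √(S.δ (S.blk i)) = s at *
    generalize √(x i) = w at *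
    rw [← hs2, ← hw2]
    have e : s * (S.ε (S.blk i) / (2 * s ^ 2) + S.ε (S.blk i) / 2 * w ^ 2) - w * S.ε (S.blk i) =
        S.ε (S.blk i) / (2 * s) * (1 - s * w) ^ 2 := by
      field_simp
      ring
    have : 0 ≤ S.ε (S.blk i) / (2 * s) * (1 - s * w) ^ 2 := by positivity
    linarith
  calc _ = ∑ i with S.blk i = k, S.ηin k * (x i * √(x i)) *
        ∑ a, S.sampling x Y a * S.lossEst x Y l a i ^ 2 := by
        simp_rw [Finset.mul_sum]
        rw [Finset.sum_comm]
        exact Finset.sum_congr rfl fun i _ => Finset.sum_congr rfl fun a _ => by ring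
    _ ≤ ∑ i with S.blk i = k, S.ηin k * (√(S.δ k) / S.ε k) * x i := by
        refine Finset.sum_le_sum fun i hi => ?_
        have hx := h.x_pos i
        calc _ ≤ S.ηin k * (x i * √(x i)) * (1 / S.obs x Y i) :=
              mul_le_mul_of_nonneg_left (sum_sampling_lossEst_sq_le h hl i) (by positivity)
          _ = S.ηin k * x i * (√(x i) * (1 / S.obs x Y i)) := by ring
          _ ≤ S.ηin k * x i * (√(S.δ k) / S.ε k) :=
              mul_le_mul_of_nonneg_left (h1 i (Finset.mem_filter.1 hi).2) (by positivity)
          _ = _ := by ring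
    _ = _ := by rw [← Finset.mul_sum, h.x_sum]; ring

/-- The learning rate of a block. -/
noncomputable def ηout (S : BlockScheme V E m) (k : Fin m) : ℝ := if k ∈ S.weak then S.η else S.ηs

theorem ηs_pos (S : BlockScheme V E m) : 0 < S.ηs := S.η_pos.trans_le S.η_le

theorem ηout_pos (S : BlockScheme V E m) (k : Fin m) : 0 < S.ηout k := by
  unfold ηout
  split_ifs
  exacts [S.η_pos, ηs_pos S]

theorem ηout_le (S : BlockScheme V E m) (k : Fin m) : S.ηout k ≤ S.ηs := by
  unfold ηout
  split_ifs
  exacts [S.η_le, le_rfl]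

theorem sum_div_obs_weak_le (h : S.IsWeights x Y) {k : Fin m} (hk : k ∈ S.weak) :
    ∑ i with S.blk i = k, x i / S.obs x Y i ≤ 1 / (S.α * √(Y k)) := by
  have hα := mul_pos S.α_pos (Real.sqrt_pos.2 (h.Y_pos k))
  calc _ ≤ ∑ i with S.blk i = k, 1 / (S.α * √(Y k)) * x i := by
        refine Finset.sum_le_sum fun i hi => ?_
        obtain rfl := (Finset.mem_filter.1 hi).2
        have h1 := explore_le_obs h hk
        have h2 := mul_pos (half_pos (S.ε_pos _ hk)) (h.x_pos i)
        have h3 := div_pos (S.ε_pos _ hk) (mul_pos two_pos (S.δ_pos _ hk))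
        unfold rate at h1
        rw [← one_div_mul_eq_div]
        exact mul_le_mul_of_nonneg_right (one_div_le_one_div_of_le hα (by linarith))
          (h.x_pos i).le
    _ = _ := by rw [← Finset.mul_sum, h.x_sum, mul_one]

theorem outer_term_le (h : S.IsWeights x Y) {l : V → ℝ} (hl : ∀ v, 0 ≤ l v ∧ l v ≤ 1)
    (k : Fin m) (hk : ∀ i, S.blk i = k → k ∉ S.weak → ¬ E i i → Y k ≤ 1 / 2) :
    ∑ a, S.sampling x Y a * (S.ηout k * (Y k * √(Y k)) * S.blockEst x Y l a k ^ 2) ≤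
      S.η / S.α * Y k + 2 * S.ηs := by
  have hY := h.Y_pos k
  have hη := ηout_pos S k
  have hα := S.α_pos
  have hη0 := S.η_pos
  have hηs := ηs_pos S
  have hs : 0 < √(Y k) := Real.sqrt_pos.2 hY
  have hs1 : √(Y k) ≤ 1 := Real.sqrt_le_one.2 (h.Y_le_one k)
  have h1 : ∑ a, S.sampling x Y a * (S.ηout k * (Y k * √(Y k)) * S.blockEst x Y l a k ^ 2) ≤
      S.ηout k * (Y k * √(Y k)) * ∑ i with S.blk i = k, x i / S.obs x Y i := by
    refine le_trans (le_of_eq ?_) (mul_le_mul_of_nonneg_left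
      (sum_sampling_blockEst_sq_le h hl k) (by positivity))
    rw [Finset.mul_sum]
    exact Finset.sum_congr rfl fun a _ => by ring
  refine h1.trans ?_
  by_cases hw : k ∈ S.weak
  · calc _ ≤ S.ηout k * (Y k * √(Y k)) * (1 / (S.α * √(Y k))) :=
          mul_le_mul_of_nonneg_left (sum_div_obs_weak_le h hw) (by positivity)
      _ = S.η / S.α * Y k := by
          rw [ηout, if_pos hw]
          field_simp
      _ ≤ _ := by linarith
  · obtain ⟨i, rfl⟩ := S.blk_surj k
    rw [sum_single hw (fun i => x i / S.obs x Y i), h.x_single hw, ηout, if_neg hw]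
    have hq := obs_pos h i
    have h2 : Y (S.blk i) / 2 ≤ S.obs x Y i := by
      by_cases hE : E i i
      · exact half_le_obs h hw hE
      · have := one_sub_le_obs h hw hE
        have := hk i rfl hw hE
        linarith
    have h3 : Y (S.blk i) * (1 / S.obs x Y i) ≤ 2 := by
      rw [mul_one_div, div_le_iff₀ hq]
      linarith
    have h4 : S.ηs * (Y (S.blk i) * √(Y (S.blk i))) * (1 / S.obs x Y i) ≤ 2 * S.ηs := by
      calc _ = S.ηs * √(Y (S.blk i)) * (Y (S.blk i) * (1 / S.obs x Y i)) := by ring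
        _ ≤ S.ηs * √(Y (S.blk i)) * 2 := mul_le_mul_of_nonneg_left h3 (by positivity)
        _ ≤ S.ηs * 1 * 2 := by gcongr
        _ = _ := by ring
    have h5 : 0 ≤ S.η / S.α * Y (S.blk i) := by positivity
    linarith

theorem exists_outer_stability (h : S.IsWeights x Y) {l : V → ℝ} (hl : ∀ v, 0 ≤ l v ∧ l v ≤ 1) :
    ∃ (c : V → ℝ) (R : V → Fin m → ℝ),
      (∀ a k y', 0 ≤ y' → (Y k - y') * (S.blockEst x Y l a k - c a) -
        (√y' - √(Y k)) ^ 2 / (S.ηout k * √(Y k)) ≤ R a k) ∧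
      ∑ a, S.sampling x Y a * ∑ k, R a k ≤ S.η / S.α + (2 * m + 2) * S.ηs := by
  have hηs := ηs_pos S
  have hsum : ∀ s : Finset (Fin m), ∑ k ∈ s, (S.η / S.α * Y k + 2 * S.ηs) ≤
      S.η / S.α + 2 * m * S.ηs := by
    intro s
    have hα := S.α_pos
    have hη0 := S.η_pos
    calc _ ≤ ∑ k, (S.η / S.α * Y k + 2 * S.ηs) :=
          Finset.sum_le_sum_of_subset_of_nonneg (Finset.subset_univ s) fun k _ _ => by
            have := h.Y_pos k
            positivity
      _ = _ := by
          rw [Finset.sum_add_distrib, ← Finset.mul_sum, h.Y_sum, Finset.sum_const,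
            Finset.card_univ, Fintype.card_fin, nsmul_eq_mul]
          ring
  by_cases hbig : ∃ i, S.blk i ∉ S.weak ∧ ¬ E i i ∧ 1 / 2 < Y (S.blk i)
  · obtain ⟨i, hw, hE, hi⟩ := hbig
    have hq := obs_pos h i
    refine ⟨fun a => S.lossEst x Y l a i, fun a k => if k = S.blk i then 0 else
      S.ηout k * (Y k * √(Y k)) *
        (S.blockEst x Y l a k ^ 2 + 2 * S.lossEst x Y l a i ^ 2), ?_, ?_⟩
    · intro a k y' hy'
      beta_reduce
      by_cases hk : k = S.blk i
      · subst hk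
        rw [if_pos rfl, blockEst_single h hw, sub_self, mul_zero, zero_sub]
        exact neg_nonpos.2 (div_nonneg (sq_nonneg _)
          (mul_nonneg (ηout_pos S _).le (Real.sqrt_nonneg _)))
      · rw [if_neg hk]
        refine tsallis_stability (ηout_pos S k) (h.Y_pos k) hy' (blockEst_nonneg h hl a k)
          (lossEst_nonneg h hl a i) ?_
        have hs1 : √(Y k) ≤ 1 := Real.sqrt_le_one.2 (h.Y_le_one k)
        have e1 : S.lossEst x Y l a i ≤ 1 / ∑ k ∈ S.weak, S.ε k :=
          (lossEst_le h hl a i).trans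
            (one_div_le_one_div_of_le (sum_ε_pos S) (sum_ε_le_obs h hw hE))
        have e2 := lossEst_nonneg h hl a i
        have e3 := sum_ε_pos S
        calc _ ≤ S.ηs * (1 / ∑ k ∈ S.weak, S.ε k) * 1 := by
              have := ηout_le S k
              gcongr
          _ ≤ 1 / 2 := by
              rw [mul_one, mul_one_div, div_le_iff₀ e3]
              linarith [S.ηs_le]
    · have hrest : ∑ k ∈ Finset.univ.erase (S.blk i), Y k = 1 - Y (S.blk i) := by
        rw [eq_sub_iff_add_eq, Finset.sum_erase_add _ _ (Finset.mem_univ _), h.Y_sum]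
      have hsmall : ∀ k ∈ Finset.univ.erase (S.blk i), Y k ≤ 1 / 2 := by
        intro k hk
        have := Finset.single_le_sum (f := Y) (fun k _ => (h.Y_pos k).le) hk
        linarith
      have hc2 : ∑ a, S.sampling x Y a * (∑ k ∈ Finset.univ.erase (S.blk i),
          S.ηout k * (Y k * √(Y k)) * (2 * S.lossEst x Y l a i ^ 2)) ≤ 2 * S.ηs := by
        have e1 : ∑ k ∈ Finset.univ.erase (S.blk i), S.ηout k * (Y k * √(Y k)) ≤
            S.ηs * (1 - Y (S.blk i)) := by
          rw [← hrest, Finset.mul_sum]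
          refine Finset.sum_le_sum fun k _ => ?_
          have hY := h.Y_pos k
          have hs1 : √(Y k) ≤ 1 := Real.sqrt_le_one.2 (h.Y_le_one k)
          exact mul_le_mul (ηout_le S k) (mul_le_of_le_one_right hY.le hs1) (by positivity) hηs.le
        have e2 : 0 ≤ 1 - Y (S.blk i) := by linarith [h.Y_le_one (S.blk i)]
        calc _ = 2 * (∑ k ∈ Finset.univ.erase (S.blk i), S.ηout k * (Y k * √(Y k))) *
              ∑ a, S.sampling x Y a * S.lossEst x Y l a i ^ 2 := by
              rw [Finset.mul_sum]
              refine Finset.sum_congr rfl fun a _ => ?_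
              rw [← Finset.sum_mul]
              ring
          _ ≤ 2 * (S.ηs * (1 - Y (S.blk i))) * (1 / S.obs x Y i) :=
              mul_le_mul (by linarith) (sum_sampling_lossEst_sq_le h hl i)
                (Finset.sum_nonneg fun a _ => mul_nonneg (sampling_nonneg h a) (sq_nonneg _))
                (by positivity)
          _ = 2 * S.ηs * ((1 - Y (S.blk i)) / S.obs x Y i) := by ring
          _ ≤ 2 * S.ηs * 1 := by
              refine mul_le_mul_of_nonneg_left ?_ (by positivity)
              rw [div_le_one hq]
              exact one_sub_le_obs h hw hE
          _ = _ := mul_one _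
      calc _ = ∑ k ∈ Finset.univ.erase (S.blk i), ∑ a, S.sampling x Y a *
              (S.ηout k * (Y k * √(Y k)) * S.blockEst x Y l a k ^ 2) +
            ∑ a, S.sampling x Y a * (∑ k ∈ Finset.univ.erase (S.blk i),
              S.ηout k * (Y k * √(Y k)) * (2 * S.lossEst x Y l a i ^ 2)) := by
            rw [Finset.sum_comm, ← Finset.sum_add_distrib]
            refine Finset.sum_congr rfl fun a _ => ?_
            beta_reduce
            rw [← Finset.sum_erase_add _ _ (Finset.mem_univ (S.blk i)), if_pos rfl, add_zero,
              ← Finset.mul_sum, ← mul_add, ← Finset.sum_add_distrib]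
            congr 1
            refine Finset.sum_congr rfl fun k hk => ?_
            rw [if_neg (Finset.ne_of_mem_erase hk)]
            ring
        _ ≤ ∑ k ∈ Finset.univ.erase (S.blk i), (S.η / S.α * Y k + 2 * S.ηs) + 2 * S.ηs :=
            add_le_add (Finset.sum_le_sum fun k hk =>
              outer_term_le h hl k fun _ _ _ _ => hsmall k hk) hc2
        _ ≤ _ := by
            have := hsum (Finset.univ.erase (S.blk i))
            linarith
  · push Not at hbig
    refine ⟨fun _ => 0, fun a k => S.ηout k * (Y k * √(Y k)) * S.blockEst x Y l a k ^ 2, ?_, ?_⟩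
    · intro a k y' hy'
      have := tsallis_stability (c := 0) (ηout_pos S k) (h.Y_pos k) hy'
        (blockEst_nonneg h hl a k) le_rfl (by norm_num)
      simpa using this
    · calc _ = ∑ k, ∑ a, S.sampling x Y a *
              (S.ηout k * (Y k * √(Y k)) * S.blockEst x Y l a k ^ 2) := by
            rw [Finset.sum_comm]
            exact Finset.sum_congr rfl fun a _ => Finset.mul_sum _ _ _
        _ ≤ ∑ k, (S.η / S.α * Y k + 2 * S.ηs) :=
            Finset.sum_le_sum fun k _ => outer_term_le h hl k fun i hi hw hE => by
              subst hi
              exact hbig i hw (by simpa using hE)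
        _ ≤ _ := by
            have := hsum Finset.univ
            linarith

/-- The distribution inside the blocks chosen for the cumulative loss estimates `G`. -/
noncomputable def innerWeights (S : BlockScheme V E m) (G : V → ℝ) (v : V) : ℝ :=
  tsallisPoint {u | S.blk u = S.blk v} (fun _ => S.ηin (S.blk v)) G v

/-- The distribution over blocks chosen for the cumulative loss estimates `H`. -/
noncomputable def outerWeights (S : BlockScheme V E m) (H : Fin m → ℝ) : Fin m → ℝ :=
  tsallisPoint Finset.univ S.ηout H

theorem isTsallisPoint_innerWeights (S : BlockScheme V E m) (G : V → ℝ) (k : Fin m) :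
    IsTsallisPoint {v | S.blk v = k} (fun _ => S.ηin k) G (S.innerWeights G) := by
  obtain ⟨v, hv⟩ := S.blk_surj k
  have h := isTsallisPoint_tsallisPoint (s := Finset.univ.filter fun v => S.blk v = k)
    (η := fun _ => S.ηin k) ⟨v, by simp [hv]⟩ (fun _ _ => S.ηin_pos k) G
  have e : ∀ j ∈ Finset.univ.filter (fun v => S.blk v = k), S.innerWeights G j =
      tsallisPoint {v | S.blk v = k} (fun _ => S.ηin k) G j := by
    intro j hj
    obtain rfl := (Finset.mem_filter.1 hj).2
    rfl
  refine ⟨fun j hj => (e j hj).symm ▸ h.pos j hj, ?_, ?_⟩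
  · rw [Finset.sum_congr rfl e, h.sum_eq_one]
  · obtain ⟨c, hc⟩ := h.stationary
    exact ⟨c, fun j hj => (e j hj).symm ▸ hc j hj⟩

theorem isTsallisPoint_outerWeights (S : BlockScheme V E m) (H : Fin m → ℝ) :
    IsTsallisPoint Finset.univ S.ηout H (S.outerWeights H) :=
  isTsallisPoint_tsallisPoint ⟨S.weak_nonempty.choose, Finset.mem_univ _⟩
    (fun k _ => ηout_pos S k) H

theorem isWeights (S : BlockScheme V E m) (G : V → ℝ) (H : Fin m → ℝ) :
    S.IsWeights (S.innerWeights G) (S.outerWeights H) where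
  x_pos v := (isTsallisPoint_innerWeights S G (S.blk v)).pos v (by simp)
  x_sum k := (isTsallisPoint_innerWeights S G k).sum_eq_one
  Y_pos k := (isTsallisPoint_outerWeights S H).pos k (Finset.mem_univ k)
  Y_sum := (isTsallisPoint_outerWeights S H).sum_eq_one

/-- The update of the cumulative loss estimates by a feedback. -/
noncomputable def update (S : BlockScheme V E m) (σ : (V → ℝ) × (Fin m → ℝ)) (F : V → Option ℝ) :
    (V → ℝ) × (Fin m → ℝ) :=
  let x := S.innerWeights σ.1
  let est : V → ℝ := fun i => (F i).elim 0 (· / S.obs x (S.outerWeights σ.2) i)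
  (fun i => σ.1 i + est i, fun k => σ.2 k + ∑ i with S.blk i = k, x i * est i)

theorem update_feedbackOf (S : BlockScheme V E m) (σ : (V → ℝ) × (Fin m → ℝ)) (l : V → ℝ) (a : V) :
    S.update σ (feedbackOf E l a) =
      (fun i => σ.1 i + S.lossEst (S.innerWeights σ.1) (S.outerWeights σ.2) l a i,
        fun k => σ.2 k + S.blockEst (S.innerWeights σ.1) (S.outerWeights σ.2) l a k) := by
  have e : ∀ i, (feedbackOf E l a i).elim 0
      (· / S.obs (S.innerWeights σ.1) (S.outerWeights σ.2) i) =
      S.lossEst (S.innerWeights σ.1) (S.outerWeights σ.2) l a i := by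
    intro i
    unfold feedbackOf lossEst
    split_ifs <;> rfl
  simp only [update, e, blockEst]

/-- The cumulative loss estimates after a history. -/
noncomputable def state (S : BlockScheme V E m) (h : List (V × (V → Option ℝ))) :
    (V → ℝ) × (Fin m → ℝ) :=
  h.foldl (fun σ r => S.update σ r.2) (fun _ => 0, fun _ => 0)

theorem state_append (S : BlockScheme V E m) (h : List (V × (V → Option ℝ)))
    (r : V × (V → Option ℝ)) : S.state (h ++ [r]) = S.update (S.state h) r.2 := by
  simp [state, List.foldl_append]

/-- The difference of the regularized losses of the comparator `i` and of the strategy, for the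
cumulative loss estimates `σ`. -/
noncomputable def potential (S : BlockScheme V E m) (i : V) (σ : (V → ℝ) × (Fin m → ℝ)) : ℝ :=
  (σ.2 (S.blk i) - tsallisObjective Finset.univ S.ηout σ.2 (S.outerWeights σ.2)) +
  (σ.1 i - tsallisObjective {v | S.blk v = S.blk i} (fun _ => S.ηin (S.blk i)) σ.1
    (S.innerWeights σ.1))

theorem potential_nonneg (S : BlockScheme V E m) (i : V) (σ : (V → ℝ) × (Fin m → ℝ)) :
    0 ≤ S.potential i σ := by
  have h1 := (isTsallisPoint_outerWeights S σ.2).objective_le (fun k _ => ηout_pos S k)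
    (Finset.mem_univ (S.blk i))
  have h2 := (isTsallisPoint_innerWeights S σ.1 (S.blk i)).objective_le
    (fun _ _ => S.ηin_pos _) (i := i) (by simp)
  unfold potential
  linarith

/-- The stability cost of a round inside a block. -/
noncomputable def innerCost (S : BlockScheme V E m) (k : Fin m) : ℝ :=
  if k ∈ S.weak then S.ηin k * √(S.δ k) / S.ε k else 0

/-- The regret cost of a round against a comparator in the block `k`. -/
noncomputable def roundCost (S : BlockScheme V E m) (k : Fin m) : ℝ :=
  S.α * √(∑ k ∈ S.weak, S.δ k ^ 2) + ∑ k ∈ S.weak, S.ε k +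
    (S.η / S.α + (2 * m + 2) * S.ηs) + S.innerCost k

theorem exists_inner_stability (h : S.IsWeights x Y) {l : V → ℝ} (hl : ∀ v, 0 ≤ l v ∧ l v ≤ 1)
    (k : Fin m) :
    ∃ R : V → V → ℝ,
      (∀ a i (x' : V → ℝ), S.blk i = k → (∀ j, 0 ≤ x' j) → (∑ j with S.blk j = k, x' j = 1) →
        (x i - x' i) * (S.lossEst x Y l a i - 0) -
        (√(x' i) - √(x i)) ^ 2 / (S.ηin k * √(x i)) ≤ R a i) ∧
      ∑ a, S.sampling x Y a * ∑ i with S.blk i = k, R a i ≤ S.innerCost k := by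
  by_cases hk : k ∈ S.weak
  · refine ⟨fun a i => S.ηin k * (x i * √(x i)) * S.lossEst x Y l a i ^ 2, ?_, ?_⟩
    · intro a i x' hi hx' _
      have := tsallis_stability (c := 0) (S.ηin_pos k) (h.x_pos i) (hx' i)
        (lossEst_nonneg h hl a i) le_rfl (by norm_num)
      simpa using this
    · rw [innerCost, if_pos hk]
      exact sum_inner_stability_le h hl hk
  · refine ⟨fun _ _ => 0, ?_, by simp [innerCost, hk]⟩
    rintro a i x' rfl hx' hs
    rw [sum_single hk x'] at hs
    rw [hs, h.x_single hk]
    simp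

theorem sum_potential_le (S : BlockScheme V E m) (i : V) (σ : (V → ℝ) × (Fin m → ℝ)) {l : V → ℝ}
    (hl : ∀ v, 0 ≤ l v ∧ l v ≤ 1) :
    ∑ a, S.sampling (S.innerWeights σ.1) (S.outerWeights σ.2) a *
      (l a + S.potential i (S.update σ (feedbackOf E l a))) ≤
      S.potential i σ + (l i + S.roundCost (S.blk i)) := by
  have h := isWeights S σ.1 σ.2
  obtain ⟨c, Rout, hRout, hRout'⟩ := exists_outer_stability h hl
  obtain ⟨Rin, hRin, hRin'⟩ := exists_inner_stability h hl (S.blk i)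
  have hstep : ∀ a, S.potential i (S.update σ (feedbackOf E l a)) ≤ S.potential i σ -
      ∑ k, S.outerWeights σ.2 k *
        S.blockEst (S.innerWeights σ.1) (S.outerWeights σ.2) l a k +
      ∑ k, Rout a k + ∑ j with S.blk j = S.blk i, Rin a j +
      S.lossEst (S.innerWeights σ.1) (S.outerWeights σ.2) l a i := by
    intro a
    rw [update_feedbackOf]
    set x := S.innerWeights σ.1
    set Y := S.outerWeights σ.2
    have hG' := isTsallisPoint_innerWeights S (fun i => σ.1 i + S.lossEst x Y l a i)
    have hH' := isTsallisPoint_outerWeights S (fun k => σ.2 k + S.blockEst x Y l a k)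
    have e1 := (isTsallisPoint_outerWeights S σ.2).sum_mul_le (fun k _ => ηout_pos S k) hH' (c a)
      (Rout a) (fun k _ => hRout a k _ (hH'.pos k (Finset.mem_univ k)).le)
    have e2 := (isTsallisPoint_innerWeights S σ.1 (S.blk i)).sum_mul_le
      (fun _ _ => S.ηin_pos _) (hG' (S.blk i)) 0
      (Rin a) (fun j hj => hRin a j _ (Finset.mem_filter.1 hj).2
        (fun v => ((hG' (S.blk v)).pos v (by simp)).le) (hG' (S.blk i)).sum_eq_one)
    have e3 : S.blockEst x Y l a (S.blk i) =
      ∑ j with S.blk j = S.blk i, x j * S.lossEst x Y l a j := rfl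
    unfold potential
    linarith
  set x := S.innerWeights σ.1
  set Y := S.outerWeights σ.2
  have h1 : ∑ a, S.sampling x Y a * ∑ k, Y k * S.blockEst x Y l a k =
      ∑ v, Y (S.blk v) * x v * l v := by
    rw [sum_eq_sum_blk (S := S) fun v => Y (S.blk v) * x v * l v]
    simp_rw [Finset.mul_sum]
    rw [Finset.sum_comm]
    refine Finset.sum_congr rfl fun k _ => ?_
    simp_rw [mul_assoc]
    rw [sum_blk_mul Y, ← sum_sampling_blockEst h, Finset.mul_sum]
    exact Finset.sum_congr rfl fun a _ => by ring
  calc _ ≤ ∑ a, S.sampling x Y a * (l a + (S.potential i σ - ∑ k, Y k * S.blockEst x Y l a k +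
        ∑ k, Rout a k + ∑ j with S.blk j = S.blk i, Rin a j + S.lossEst x Y l a i)) :=
        Finset.sum_le_sum fun a _ => mul_le_mul_of_nonneg_left
          (by linarith [hstep a]) (sampling_nonneg h a)
    _ = ∑ a, S.sampling x Y a * l a + (∑ a, S.sampling x Y a) * S.potential i σ -
        ∑ a, S.sampling x Y a * ∑ k, Y k * S.blockEst x Y l a k +
        ∑ a, S.sampling x Y a * ∑ k, Rout a k +
        ∑ a, S.sampling x Y a * ∑ j with S.blk j = S.blk i, Rin a j +
        ∑ a, S.sampling x Y a * S.lossEst x Y l a i := by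
        rw [Finset.sum_mul, ← Finset.sum_add_distrib, ← Finset.sum_sub_distrib,
          ← Finset.sum_add_distrib, ← Finset.sum_add_distrib, ← Finset.sum_add_distrib]
        exact Finset.sum_congr rfl fun a _ => by ring
    _ ≤ _ := by
        rw [sum_sampling h, sum_sampling_lossEst h, h1]
        have := sum_sampling_mul_le h hl
        unfold roundCost
        linarith

theorem sum_sqrt_le {ι : Type*} (s : Finset ι) {y : ι → ℝ} (hy : ∀ i ∈ s, 0 ≤ y i)
    (h1 : ∑ i ∈ s, y i ≤ 1) : ∑ i ∈ s, √(y i) ≤ √(s.card : ℝ) := by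
  have h2 := Real.sum_mul_le_sqrt_mul_sqrt s (fun _ => (1 : ℝ)) (fun i => √(y i))
  simp only [one_mul, one_pow, Finset.sum_const, nsmul_eq_mul, mul_one] at h2
  rw [Finset.sum_congr rfl fun i hi => Real.sq_sqrt (hy i hi)] at h2
  exact h2.trans (mul_le_of_le_one_right (Real.sqrt_nonneg _) (Real.sqrt_le_one.2 h1))

theorem potential_zero_le (S : BlockScheme V E m) (i : V) :
    S.potential i (fun _ => 0, fun _ => 0) ≤ 2 * √(S.weak.card : ℝ) / S.η + 2 * m / S.ηs +
      2 * √((Finset.univ.filter fun v => S.blk v = S.blk i).card : ℝ) / S.ηin (S.blk i) := by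
  have h := isWeights S (fun _ => 0) (fun _ => 0)
  have hη0 := S.η_pos
  have hηs := ηs_pos S
  have hin := S.ηin_pos (S.blk i)
  set x := S.innerWeights fun _ => 0
  set Y := S.outerWeights fun _ => 0
  have h1 : ∑ k, √(Y k) / S.ηout k ≤ √(S.weak.card : ℝ) / S.η + m / S.ηs := by
    have e : ∀ k, √(Y k) / S.ηout k ≤ (if k ∈ S.weak then √(Y k) / S.η else 0) + 1 / S.ηs := by
      intro k
      unfold ηout
      split_ifs
      · have : 0 ≤ 1 / S.ηs := by positivity
        linarith
      · rw [zero_add]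
        exact div_le_div_of_nonneg_right (Real.sqrt_le_one.2 (h.Y_le_one k)) hηs.le
    refine (Finset.sum_le_sum fun k _ => e k).trans ?_
    rw [Finset.sum_add_distrib, Finset.sum_const, Finset.card_univ, Fintype.card_fin,
      nsmul_eq_mul, mul_one_div, Finset.sum_ite_mem, Finset.univ_inter, ← Finset.sum_div]
    gcongr
    refine sum_sqrt_le _ (fun k _ => (h.Y_pos k).le) ?_
    rw [← h.Y_sum]
    exact Finset.sum_le_sum_of_subset_of_nonneg (Finset.subset_univ _)
      fun k _ _ => (h.Y_pos k).le
  have h2 : ∑ v with S.blk v = S.blk i, √(x v) ≤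
      √((Finset.univ.filter fun v => S.blk v = S.blk i).card : ℝ) :=
    sum_sqrt_le _ (fun v _ => (h.x_pos v).le) (h.x_sum _).le
  have h3 : S.potential i (fun _ => 0, fun _ => 0) = 2 * ∑ k, √(Y k) / S.ηout k +
      2 * (∑ v with S.blk v = S.blk i, √(x v)) / S.ηin (S.blk i) := by
    unfold potential tsallisObjective
    simp only [mul_zero, zero_sub, Finset.sum_neg_distrib, neg_neg, Finset.mul_sum,
      Finset.sum_div, mul_div_assoc]
    rfl
  rw [h3]
  have h4 : 2 * (∑ v with S.blk v = S.blk i, √(x v)) / S.ηin (S.blk i) ≤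
      2 * √((Finset.univ.filter fun v => S.blk v = S.blk i).card : ℝ) / S.ηin (S.blk i) := by
    gcongr
  have e1 : 2 * √(S.weak.card : ℝ) / S.η + 2 * m / S.ηs =
      2 * (√(S.weak.card : ℝ) / S.η + m / S.ηs) := by ring
  rw [e1]
  linarith

theorem exists_policy_regretTo_le (S : BlockScheme V E m) (T : ℕ) :
    ∃ π : Policy V, ∀ ℓ : ℕ → V → ℝ, ValidLoss ℓ → ∀ i : V,
      regretTo π E ℓ T i ≤ T * S.roundCost (S.blk i) +
        (2 * √(S.weak.card : ℝ) / S.η + 2 * m / S.ηs +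
          2 * √((Finset.univ.filter fun v => S.blk v = S.blk i).card : ℝ) / S.ηin (S.blk i)) := by
  have hp : ∀ h : List (V × (V → Option ℝ)), ∃ μ : PMF V, ∀ v, (μ v).toReal =
      S.sampling (S.innerWeights (S.state h).1) (S.outerWeights (S.state h).2) v := fun h =>
    exists_pmf (sampling_nonneg (isWeights S _ _)) (sum_sampling (isWeights S _ _))
  choose π hπ using hp
  refine ⟨π, fun ℓ hℓ i => ?_⟩
  have := expectedLoss_le_of_potential π E ℓ (fun h => S.potential i (S.state h))
    (fun t => ℓ t i + S.roundCost (S.blk i)) (fun h => potential_nonneg S i _)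
    (fun t h => by
      simp_rw [hπ, state_append]
      exact sum_potential_le S i _ (hℓ t)) T
  rw [Finset.sum_add_distrib, Finset.sum_const, Finset.card_univ, Fintype.card_fin,
    nsmul_eq_mul] at this
  have h0 := potential_zero_le S i
  unfold regretTo
  have e : S.state [] = (fun _ => 0, fun _ => 0) := rfl
  rw [e] at this
  linarith

end BlockScheme

end Scheme

section Tuning

/-- Weighted arithmetic-geometric mean inequality in the form used to bound the exploration. -/
theorem mul_sq_le_cubes {x y : ℝ} (hx : 0 ≤ x) (hy : 0 ≤ y) :
    x * y ^ 2 ≤ (x ^ 3 + 2 * y ^ 3) / 3 := by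
  nlinarith [mul_nonneg (add_nonneg hx (add_nonneg hy hy)) (sq_nonneg (x - y))]

theorem sqrt_eq_cbrt_pow (a : ℝ) : (√a ^ ((1 : ℝ) / 3)) ^ 3 = √a := by
  rw [← Real.rpow_natCast, ← Real.rpow_mul (Real.sqrt_nonneg a)]
  norm_num

theorem cbrt_pow {a : ℝ} (ha : 0 ≤ a) : (a ^ ((1 : ℝ) / 3)) ^ 3 = a := by
  rw [← Real.rpow_natCast, ← Real.rpow_mul ha]
  norm_num

theorem add_terms_le {t u D F M N A₁ A₂ A₃ A₄ A₅ B₁ B₂ B₃ : ℝ} (h₁ : t * A₁ = D * u)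
    (h₂ : t * A₂ = F * u) (h₃ : t * A₃ = 2 * D * u) (h₄ : t * A₄ = M * u) (h₅ : B₁ = D * u)
    (h₆ : B₂ + 2 ≤ 1 / 10 * u) (h₇ : t * A₅ + B₃ ≤ N * u + 2) (hF : F * u ≤ 128 / 225 * D * u)
    (hM : M * u ≤ 1 / 20 * u) (hu : 0 ≤ u) (hD : u ≤ D * u) :
    t * (A₁ + A₂ + (A₃ + A₄) + A₅) + (B₁ + B₂ + B₃) ≤ (N + 474 / 100 * D) * u := by
  linarith

/-- Parameters for which the regret of the two-level strategy has the stated order. -/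
theorem exists_params {m : ℕ} {U : Finset (Fin m)} (hU : U.Nonempty) {n δ : Fin m → ℝ}
    (hδ1 : ∀ k ∈ U, 1 ≤ δ k) (hδn : ∀ k ∈ U, δ k ≤ n k) :
    ∃ C : ℝ, ∀ τ : ℝ, C ≤ τ → 1 ≤ τ → ∃ (α η ηs : ℝ) (ε ηin : Fin m → ℝ),
      0 < α ∧ (∀ k ∈ U, 0 < ε k) ∧ 0 < η ∧ η ≤ ηs ∧ (∀ k, 0 < ηin k) ∧
      α * √(∑ k ∈ U, δ k ^ 2) + ∑ k ∈ U, ε k ≤ 1 / 2 ∧ ηs ≤ (∑ k ∈ U, ε k) / 2 ∧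
      ∀ k, (k ∉ U → n k = 1) →
        τ ^ 3 * (α * √(∑ k ∈ U, δ k ^ 2) + ∑ k ∈ U, ε k + (η / α + (2 * m + 2) * ηs) +
          (if k ∈ U then ηin k * √(δ k) / ε k else 0)) +
        (2 * √(U.card : ℝ) / η + 2 * m / ηs + 2 * √(n k) / ηin k) ≤
        (15 / 4 * ((∑ k ∈ U, √(n k)) ^ ((1 : ℝ) / 3) * √(n k) ^ ((1 : ℝ) / 3)) +
          474 / 100 * (U.card * ∑ k ∈ U, δ k ^ 2) ^ ((1 : ℝ) / 6)) * τ ^ 2 := by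
  have hn1 : ∀ k ∈ U, 1 ≤ n k := fun k hk => (hδ1 k hk).trans (hδn k hk)
  set Q := √(∑ k ∈ U, δ k ^ 2) with hQ
  set D := (U.card * ∑ k ∈ U, δ k ^ 2) ^ ((1 : ℝ) / 6) with hD
  set s := ∑ k ∈ U, √(n k) with hs
  set z := s ^ ((1 : ℝ) / 3) with hz
  set q : Fin m → ℝ := fun k => √(n k) ^ ((1 : ℝ) / 3) with hq
  have hc1 : (1 : ℝ) ≤ U.card := by exact_mod_cast hU.card_pos
  have hQ2 : (1 : ℝ) ≤ ∑ k ∈ U, δ k ^ 2 := by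
    obtain ⟨k, hk⟩ := hU
    have := Finset.single_le_sum (f := fun k => δ k ^ 2) (fun k _ => sq_nonneg _) hk
    nlinarith [hδ1 k hk]
  have hQ1 : 0 < Q := Real.sqrt_pos.2 (by linarith)
  have hK : 0 < √(U.card : ℝ) := Real.sqrt_pos.2 (by linarith)
  have hD1 : 1 ≤ D := Real.one_le_rpow (by nlinarith) (by norm_num)
  have hD0 : 0 < D := by linarith
  have hD3 : D ^ 3 = √(U.card : ℝ) * Q := by
    rw [hD, hQ, ← Real.sqrt_mul (by linarith), Real.sqrt_eq_rpow, ← Real.rpow_natCast,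
      ← Real.rpow_mul (by positivity)]
    norm_num
  have hnk : ∀ k ∈ U, 0 < √(n k) := fun k hk => Real.sqrt_pos.2 (by linarith [hn1 k hk])
  have hs0 : 0 < s := Finset.sum_pos hnk hU
  have hz0 : 0 < z := Real.rpow_pos_of_pos hs0 _
  have hz3 : z ^ 3 = s := cbrt_pow hs0.le
  have hq3 : ∀ k, q k ^ 3 = √(n k) := fun k => sqrt_eq_cbrt_pow _
  have hq0 : ∀ k ∈ U, 0 < q k := fun k hk => Real.rpow_pos_of_pos (hnk k hk) _
  have hqn : ∀ k, 0 ≤ q k := fun k => Real.rpow_nonneg (Real.sqrt_nonneg _) _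
  have hδ0 : ∀ k ∈ U, 0 < √(δ k) := fun k hk => Real.sqrt_pos.2 (by linarith [hδ1 k hk])
  set e : Fin m → ℝ := fun k => 128 / 225 * (q k * √(δ k) / z ^ 2) with he
  set g : Fin m → ℝ := fun k => 16 / 15 * (q k ^ 2 / z) with hg
  have he0 : ∀ k ∈ U, 0 < e k := fun k hk => by
    have := hq0 k hk
    have := hδ0 k hk
    positivity
  have hg0 : ∀ k ∈ U, 0 < g k := fun k hk => by
    have := hq0 k hk
    positivity
  have hesum : ∑ k ∈ U, e k ≤ 128 / 225 * D := by
    have h1 : ∀ k ∈ U, q k * √(δ k) / z ^ 2 ≤ D * ((δ k / D ^ 3 + 2 * (√(n k) / s)) / 3) := by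
      intro k hk
      have hδk := hδ1 k hk
      have hq := hq0 k hk
      set r := δ k ^ ((1 : ℝ) / 3) with hr
      have hr0 : 0 < r := Real.rpow_pos_of_pos (by linarith) _
      have hr3 : r ^ 3 = δ k := cbrt_pow (by linarith)
      have hrq : r ≤ q k ^ 2 := by
        refine le_of_pow_le_pow_left₀ (n := 3) (by norm_num) (by positivity) ?_
        rw [hr3, ← pow_mul, mul_comm, pow_mul, hq3, Real.sq_sqrt (by linarith [hn1 k hk])]
        exact hδn k hk
      have h2 : √(δ k) ≤ r * q k := by
        refine Real.sqrt_le_iff.2 ⟨by positivity, ?_⟩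
        rw [← hr3]
        nlinarith [mul_le_mul_of_nonneg_left hrq (sq_nonneg r)]
      have h3 := mul_sq_le_cubes (div_pos hr0 hD0).le (div_pos hq hz0).le
      calc q k * √(δ k) / z ^ 2 ≤ q k * (r * q k) / z ^ 2 := by gcongr
        _ = D * ((r / D) * (q k / z) ^ 2) := by field_simp
        _ ≤ D * (((r / D) ^ 3 + 2 * (q k / z) ^ 3) / 3) := by gcongr
        _ = _ := by rw [div_pow, div_pow, hr3, hz3, hq3]
    have h4 : ∑ k ∈ U, δ k ≤ D ^ 3 := by
      rw [hD3]
      have := Real.sum_mul_le_sqrt_mul_sqrt U (fun _ => (1 : ℝ)) δ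
      simpa using this
    calc ∑ k ∈ U, e k ≤ ∑ k ∈ U, 128 / 225 * (D * ((δ k / D ^ 3 + 2 * (√(n k) / s)) / 3)) :=
          Finset.sum_le_sum fun k hk => mul_le_mul_of_nonneg_left (h1 k hk) (by norm_num)
      _ = 128 / 225 * (D * (((∑ k ∈ U, δ k) / D ^ 3 + 2 * (s / s)) / 3)) := by
          rw [← Finset.mul_sum, ← Finset.mul_sum, ← Finset.sum_div, Finset.sum_add_distrib,
            ← Finset.sum_div, ← Finset.mul_sum, ← Finset.sum_div]
      _ ≤ 128 / 225 * (D * ((1 + 2 * 1) / 3)) := by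
          rw [div_self hs0.ne']
          have := (div_le_one (by positivity)).2 h4
          gcongr
      _ = _ := by ring
  have hesum0 : 0 < ∑ k ∈ U, e k := Finset.sum_pos he0 hU
  set lam := min ((∑ k ∈ U, e k) / 2) (1 / (20 * (2 * m + 2))) with hlam
  have hlam0 : 0 < lam := lt_min (by linarith) (by positivity)
  have hlam1 : lam ≤ (∑ k ∈ U, e k) / 2 := min_le_left _ _
  have hlam2 : (2 * m + 2) * lam ≤ 1 / 20 := by
    calc (2 * m + 2) * lam ≤ (2 * m + 2) * (1 / (20 * (2 * m + 2))) := by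
          gcongr
          exact min_le_right _ _
      _ = 1 / 20 := by field_simp
  set b := 2 * √(U.card : ℝ) / D with hb
  have hb0 : 0 < b := by positivity
  refine ⟨max (2 * (D + ∑ k ∈ U, e k)) (max (b / lam) (10 * (2 * m / lam + 2))),
    fun τ hτ hτ1 => ?_⟩
  have hτ2 : 2 * (D + ∑ k ∈ U, e k) ≤ τ := (le_max_left _ _).trans hτ
  have hτ3 : b / lam ≤ τ := (le_max_left _ _).trans ((le_max_right _ _).trans hτ)
  have hτ4 : 10 * (2 * m / lam + 2) ≤ τ := (le_max_right _ _).trans ((le_max_right _ _).trans hτ)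
  have hτ0 : 0 < τ := by linarith
  have heτ : ∑ k ∈ U, e k / τ = (∑ k ∈ U, e k) / τ := (Finset.sum_div _ _ _).symm
  refine ⟨D / Q / τ, b / τ ^ 2, lam / τ, fun k => e k / τ,
    fun k => if k ∈ U then g k / τ ^ 2 else 1, by positivity,
    fun k hk => div_pos (he0 k hk) hτ0, by positivity, ?_, ?_, ?_, ?_, ?_⟩
  · rw [div_le_iff₀ hlam0] at hτ3
    rw [div_le_div_iff₀ (by positivity) hτ0]
    nlinarith
  · intro k
    beta_reduce
    split_ifs with hk
    · exact div_pos (hg0 k hk) (by positivity)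
    · exact one_pos
  · rw [heτ]
    have : D / Q / τ * Q = D / τ := by field_simp
    rw [this, ← add_div, div_le_iff₀ hτ0]
    linarith
  · rw [heτ, div_right_comm]
    gcongr
  · intro k hk
    beta_reduce
    rw [heτ]
    have hlow : 2 * m / (lam / τ) + 2 ≤ 1 / 10 * τ ^ 2 := by
      have e1 : 2 * m / (lam / τ) = 2 * m / lam * τ := by field_simp
      rw [e1]
      nlinarith
    have e1 : τ ^ 3 * (D / Q / τ * Q) = D * τ ^ 2 := by field_simp
    have e2 : τ ^ 3 * ((∑ k ∈ U, e k) / τ) = (∑ k ∈ U, e k) * τ ^ 2 := by field_simp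
    have e3 : τ ^ 3 * (b / τ ^ 2 / (D / Q / τ)) = 2 * D * τ ^ 2 := by
      have : b * Q = 2 * D * D := by
        rw [hb]
        field_simp
        linarith
      have h : τ ^ 3 * (b / τ ^ 2 / (D / Q / τ)) = b * Q / D * τ ^ 2 := by field_simp
      rw [h, this]
      field_simp
    have e4 : τ ^ 3 * ((2 * m + 2) * (lam / τ)) = ((2 * m + 2) * lam) * τ ^ 2 := by field_simp
    have e5 : 2 * √(U.card : ℝ) / (b / τ ^ 2) = D * τ ^ 2 := by
      rw [hb]
      field_simp
    have e6 : τ ^ 3 * (if k ∈ U then (if k ∈ U then g k / τ ^ 2 else 1) * √(δ k) / (e k / τ)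
        else 0) + 2 * √(n k) / (if k ∈ U then g k / τ ^ 2 else 1) ≤
        15 / 4 * (z * q k) * τ ^ 2 + 2 := by
      by_cases h : k ∈ U
      · simp only [if_pos h]
        have h1 := hq0 k h
        have h2 := hδ0 k h
        have : τ ^ 3 * (g k / τ ^ 2 * √(δ k) / (e k / τ)) + 2 * √(n k) / (g k / τ ^ 2) =
            15 / 4 * (z * q k) * τ ^ 2 := by
          rw [← hq3 k, he, hg]
          beta_reduce
          field_simp
          ring
        linarith
      · simp only [if_neg h, hk h]
        have := hqn k
        have : 0 ≤ 15 / 4 * (z * q k) * τ ^ 2 := by positivity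
        simp only [Real.sqrt_one]
        linarith
    have e7 : (∑ k ∈ U, e k) * τ ^ 2 ≤ 128 / 225 * D * τ ^ 2 := by gcongr
    have e8 : ((2 * m + 2) * lam) * τ ^ 2 ≤ 1 / 20 * τ ^ 2 := by gcongr
    have e9 : τ ^ 2 ≤ D * τ ^ 2 := le_mul_of_one_le_left (by positivity) hD1
    exact add_terms_le e1 e2 e3 e4 e5 hlow e6 e7 e8 (by positivity) e9

theorem le_two_rpow_one_third : (5 / 4 : ℝ) ≤ 2 ^ ((1 : ℝ) / 3) := by
  refine le_of_pow_le_pow_left₀ (n := 3) (by norm_num) (by positivity) ?_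
  rw [cbrt_pow (by norm_num)]
  norm_num

theorem two_rpow_two_thirds : (2 : ℝ) ^ ((2 : ℝ) / 3) = (2 ^ ((1 : ℝ) / 3)) ^ 2 := by
  rw [← Real.rpow_natCast, ← Real.rpow_mul (by norm_num)]
  norm_num

theorem le_two_rpow_two_thirds : (158 / 100 : ℝ) ≤ 2 ^ ((2 : ℝ) / 3) := by
  refine le_of_pow_le_pow_left₀ (n := 3) (by norm_num) (by positivity) ?_
  rw [two_rpow_two_thirds, ← pow_mul, mul_comm, pow_mul, cbrt_pow (by norm_num)]
  norm_num

theorem two_rpow_two_thirds_le : (2 : ℝ) ^ ((2 : ℝ) / 3) ≤ 2 * 2 ^ ((1 : ℝ) / 3) := by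
  have : (2 : ℝ) ^ ((1 : ℝ) / 3) ≤ 2 := by
    refine le_of_pow_le_pow_left₀ (n := 3) (by norm_num) (by norm_num) ?_
    rw [cbrt_pow (by norm_num)]
    norm_num
  rw [two_rpow_two_thirds, sq]
  exact mul_le_mul_of_nonneg_right this (by positivity)

theorem regret_bound_le {s p D t r : ℝ} (hs : 0 ≤ s) (hp : 0 ≤ p) (hD : 0 ≤ D) (ht : 0 ≤ t)
    (hr : r ≤ (15 / 4 * (s ^ ((1 : ℝ) / 3) * √p ^ ((1 : ℝ) / 3)) + 474 / 100 * D) *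
      (t ^ ((1 : ℝ) / 3)) ^ 2) :
    r ≤ 3 * (2 * s) ^ ((1 : ℝ) / 3) * p ^ ((1 : ℝ) / 6) * t ^ ((2 : ℝ) / 3) +
      3 * 2 ^ ((2 : ℝ) / 3) * D * t ^ ((2 : ℝ) / 3) := by
  have ht2 : t ^ ((2 : ℝ) / 3) = (t ^ ((1 : ℝ) / 3)) ^ 2 := by
    rw [← Real.rpow_natCast, ← Real.rpow_mul ht]
    norm_num
  have hp6 : √p ^ ((1 : ℝ) / 3) = p ^ ((1 : ℝ) / 6) := by
    rw [Real.sqrt_eq_rpow, ← Real.rpow_mul hp]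
    norm_num
  rw [hp6] at hr
  rw [ht2, Real.mul_rpow two_pos.le hs]
  refine hr.trans ?_
  have h1 := mul_le_mul_of_nonneg_right le_two_rpow_one_third
    (show 0 ≤ s ^ ((1 : ℝ) / 3) * p ^ ((1 : ℝ) / 6) * (t ^ ((1 : ℝ) / 3)) ^ 2 by positivity)
  have h2 := mul_le_mul_of_nonneg_right le_two_rpow_two_thirds
    (show 0 ≤ D * (t ^ ((1 : ℝ) / 3)) ^ 2 by positivity)
  generalize (2 : ℝ) ^ ((1 : ℝ) / 3) = c at *
  generalize (2 : ℝ) ^ ((2 : ℝ) / 3) = d at *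
  generalize s ^ ((1 : ℝ) / 3) = z at *
  generalize p ^ ((1 : ℝ) / 6) = w at *
  generalize t ^ ((1 : ℝ) / 3) = y at *
  linarith

end Tuning

/-- On a legal partition with a nontrivial block, some policy has regret of order `T ^ (2 / 3)`
against every arm. -/
theorem exists_policy_of_legal_partition {V : Type} [Fintype V] [DecidableEq V]
    (E : V → V → Bool) (m : ℕ) (P : Fin m → Finset V)
    (hne : ∀ k, (P k).Nonempty)
    (hdisj : ∀ k k' : Fin m, k ≠ k' → Disjoint (P k) (P k'))
    (hcover : ∀ v : V, ∃ k, v ∈ P k)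
    (hU1strong : ∀ k, (P k).card = 1 → ∀ v ∈ P k, StronglyObservableVertex E v)
    (hU2obs : ∀ k, 2 ≤ (P k).card → ∀ v ∈ P k, ∃ u ∈ P k, E u v)
    (U₂ : Finset (Fin m))
    (hU₂ : U₂ = Finset.univ.filter (fun k => 2 ≤ (P k).card))
    (hU₂ne : U₂ ≠ ∅)
    (δstar : Fin m → ℝ)
    (hδ : ∀ k ∈ U₂, IsLocalFracWeakDomNumber E (P k) (δstar k)) :
    ∃ T₀ : ℕ, ∀ T : ℕ, T₀ ≤ T → ∃ π : Policy V,
      ∀ ℓ : ℕ → V → ℝ, ValidLoss ℓ → ∀ a : V, ∀ k : Fin m, a ∈ P k →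
        regretTo π E ℓ T a ≤
          (15 / 4 * ((∑ k ∈ U₂, √((P k).card : ℝ)) ^ ((1 : ℝ) / 3) *
              √((P k).card : ℝ) ^ ((1 : ℝ) / 3)) +
            474 / 100 * (U₂.card * ∑ k ∈ U₂, δstar k ^ 2) ^ ((1 : ℝ) / 6)) *
          ((T : ℝ) ^ ((1 : ℝ) / 3)) ^ 2 := by
  have hcard : ∀ k, k ∉ U₂ → (P k).card = 1 := by
    intro k hk
    have h1 := (hne k).card_pos
    have h2 : ¬ 2 ≤ (P k).card := fun h => hk (by simp [hU₂, h])
    omega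
  have hcard2 : ∀ k ∈ U₂, 2 ≤ (P k).card := by
    intro k hk
    rw [hU₂] at hk
    exact (Finset.mem_filter.1 hk).2
  have hdom : ∀ k, ∃ x : V → ℝ, k ∈ U₂ → LPFeasible E (P k) x ∧ ∑ v ∈ P k, x v = δstar k := by
    intro k
    by_cases hk : k ∈ U₂
    · obtain ⟨x, hx⟩ := (hδ k hk).1
      exact ⟨x, fun _ => hx⟩
    · exact ⟨0, fun h => absurd h hk⟩
  choose X hX using hdom
  choose blk hblk using hcover
  have hmem : ∀ v k, v ∈ P k ↔ blk v = k := by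
    intro v k
    refine ⟨fun h => ?_, fun h => h ▸ hblk v⟩
    by_contra hk
    exact Finset.disjoint_left.1 (hdisj _ _ hk) (hblk v) h
  have hfilter : ∀ k, (Finset.univ.filter fun v => blk v = k) = P k := by
    intro k
    ext v
    simp [hmem]
  have hnbr : ∀ v, ∃ u, blk v ∈ U₂ → blk u = blk v ∧ E u v := by
    intro v
    by_cases hv : blk v ∈ U₂
    · obtain ⟨u, hu, huv⟩ := hU2obs _ (hcard2 _ hv) v (hblk v)
      exact ⟨u, fun _ => ⟨(hmem u _).1 hu, huv⟩⟩
    · exact ⟨v, fun h => absurd h hv⟩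
  choose nbr hnbr using hnbr
  have hU : U₂.Nonempty := Finset.nonempty_iff_ne_empty.2 hU₂ne
  have hδ1 : ∀ k ∈ U₂, 1 ≤ δstar k := by
    intro k hk
    obtain ⟨⟨h1, h2⟩, h3⟩ := hX k hk
    obtain ⟨u, hu⟩ := hne k
    rw [← h3]
    exact (h2 u hu).trans (Finset.sum_le_sum_of_subset_of_nonneg (Finset.filter_subset _ _)
      fun v hv _ => (h1 v hv).1)
  have hδn : ∀ k ∈ U₂, δstar k ≤ ((P k).card : ℝ) := by
    intro k hk
    obtain ⟨⟨h1, h2⟩, h3⟩ := hX k hk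
    rw [← h3]
    simpa using Finset.sum_le_sum fun v hv => (h1 v hv).2
  obtain ⟨C, hC⟩ := exists_params hU (n := fun k => ((P k).card : ℝ)) hδ1 hδn
  refine ⟨⌈max C 1 ^ 3⌉₊, fun T hT => ?_⟩
  have hT0 : (0 : ℝ) ≤ T := T.cast_nonneg
  set τ := (T : ℝ) ^ ((1 : ℝ) / 3) with hτ
  have hτ3 : τ ^ 3 = T := cbrt_pow hT0
  have hτC : max C 1 ≤ τ := by
    refine le_of_pow_le_pow_left₀ (n := 3) (by norm_num) (Real.rpow_nonneg hT0 _) ?_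
    rw [hτ3]
    exact Nat.ceil_le.1 hT
  obtain ⟨α, η, ηs, ε, ηin, hα, hε, hη, hηs, hηin, hbudget, hηε, hbound⟩ :=
    hC τ ((le_max_left _ _).trans hτC) ((le_max_right _ _).trans hτC)
  let S : BlockScheme V E m :=
    { blk := blk
      weak := U₂
      dom := fun v => X (blk v) v
      nbr := nbr
      δ := δstar
      α := α
      ε := ε
      η := η
      ηs := ηs
      ηin := ηin
      blk_surj := fun k => by
        obtain ⟨v, hv⟩ := hne k
        exact ⟨v, (hmem v k).1 hv⟩
      eq_of_blk_eq := fun v hv u hu =>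
        Finset.card_le_one.1 (hcard _ hv).le u ((hmem u _).2 hu) v (hblk v)
      strong := fun v hv => hU1strong _ (hcard _ hv) v (hblk v)
      weak_nonempty := hU
      dom_nonneg := fun v hv => ((hX _ hv).1.1 v (hblk v)).1
      dom_sum := fun k hk => by
        rw [hfilter, ← (hX k hk).2]
        exact Finset.sum_congr rfl fun v hv => by rw [(hmem v k).1 hv]
      dom_cover := fun u hu => by
        refine ((hX _ hu).1.2 u (hblk u)).trans (le_of_eq ?_)
        rw [← Finset.filter_filter, hfilter]
        refine Finset.sum_congr rfl fun v hv => ?_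
        rw [(hmem v _).1 (Finset.mem_filter.1 hv).1]
      blk_nbr := fun v hv => (hnbr v hv).1
      nbr_edge := fun v hv => (hnbr v hv).2
      δ_pos := fun k hk => one_pos.trans_le (hδ1 k hk)
      α_pos := hα
      ε_pos := hε
      η_pos := hη
      η_le := hηs
      ηin_pos := hηin
      budget_le := hbudget
      ηs_le := hηε }
  obtain ⟨π, hπ⟩ := S.exists_policy_regretTo_le T
  refine ⟨π, fun ℓ hℓ a k hak => ?_⟩
  obtain rfl := (hmem a k).1 hak
  refine (hπ ℓ hℓ a).trans (le_trans (le_of_eq ?_)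
    (hbound (blk a) fun h => by rw [hcard _ h, Nat.cast_one]))
  rw [hτ3, hfilter]
  rfl

/-- Regret bounds of the adaptive realization of the regret
decomposition theorem on a legal partition `P` of the vertex set with `U₂ ≠ ∅`,
where `U₂` is the set of blocks of size at least two (each inducing an observable
subgraph), `U₁S`/`U₁Sb` are the singleton blocks whose (strongly observable) vertex
has/does not have a self-loop, `δstar k` is the local fractional weak domination
number of block `k ∈ U₂`, and `kstar` is the block containing the comparator arm. -/
theorem adaptive_realized_upper_bound {V : Type} [Fintype V] [DecidableEq V]
    (E : V → V → Bool) (m : ℕ) (P : Fin m → Finset V)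
    (hne : ∀ k, (P k).Nonempty)
    (hdisj : ∀ k k' : Fin m, k ≠ k' → Disjoint (P k) (P k'))
    (hcover : ∀ v : V, ∃ k, v ∈ P k)
    (hU1strong : ∀ k, (P k).card = 1 → ∀ v ∈ P k, StronglyObservableVertex E v)
    (hU2obs : ∀ k, 2 ≤ (P k).card → ∀ v ∈ P k, ∃ u ∈ P k, E u v)
    (U₂ U₁S U₁Sb : Finset (Fin m))
    (hU₂ : U₂ = Finset.univ.filter (fun k => 2 ≤ (P k).card))
    (hU₁S : U₁S = Finset.univ.filter (fun k => (P k).card = 1 ∧ ∃ v ∈ P k, E v v))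
    (hU₁Sb : U₁Sb = Finset.univ.filter (fun k => (P k).card = 1 ∧ ¬ ∃ v ∈ P k, E v v))
    (hU₂ne : U₂ ≠ ∅)
    (δstar : Fin m → ℝ)
    (hδ : ∀ k ∈ U₂, IsLocalFracWeakDomNumber E (P k) (δstar k)) :
    ∃ T₀ : ℕ, ∀ T : ℕ, T₀ ≤ T → ∃ π : Policy V,
      ∀ ℓ : ℕ → V → ℝ, ValidLoss ℓ → ∀ a : V, ∀ kstar : Fin m, a ∈ P kstar →
        ((U₁Sb = ∅ →
          regretTo π E ℓ T a ≤
            3 * (2 * ∑ k ∈ U₂, Real.sqrt ((P k).card : ℝ)) ^ ((1 : ℝ) / 3) *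
              ((P kstar).card : ℝ) ^ ((1 : ℝ) / 6) * (T : ℝ) ^ ((2 : ℝ) / 3) +
            3 * (2 : ℝ) ^ ((2 : ℝ) / 3) *
              ((U₂.card : ℝ) * ∑ k ∈ U₂, (δstar k) ^ 2) ^ ((1 : ℝ) / 6) *
              (T : ℝ) ^ ((2 : ℝ) / 3) +
            4 * Real.sqrt (U₁S.card : ℝ) * (T : ℝ) ^ ((1 : ℝ) / 2)) ∧
        (U₁Sb ≠ ∅ →
          regretTo π E ℓ T a ≤
            6 * (2 : ℝ) ^ ((1 : ℝ) / 3) *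
              ((U₂.card : ℝ) * ∑ k ∈ U₂, (δstar k) ^ 2) ^ ((1 : ℝ) / 6) *
              (T : ℝ) ^ ((2 : ℝ) / 3) +
            3 * (2 * ∑ k ∈ U₂, Real.sqrt ((P k).card : ℝ)) ^ ((1 : ℝ) / 3) *
              ((P kstar).card : ℝ) ^ ((1 : ℝ) / 6) * (T : ℝ) ^ ((2 : ℝ) / 3) +
            4 * Real.sqrt (6 * (U₁S.card : ℝ)) * (T : ℝ) ^ ((1 : ℝ) / 2) +
            2 * Real.sqrt (10 * Real.log ((U₁Sb.card : ℝ) + 1)) * (T : ℝ) ^ ((1 : ℝ) / 2) +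
            4 * (U₂.card : ℝ) ^ ((5 : ℝ) / 6) * (T : ℝ) ^ ((1 : ℝ) / 3) /
              ((2 : ℝ) ^ ((1 : ℝ) / 3) *
                (∑ k ∈ U₂, (δstar k) ^ 2) ^ ((1 : ℝ) / 6)) +
            Real.sqrt 6 / 3 * (T : ℝ) ^ ((1 : ℝ) / 2))) := by
  obtain ⟨T₀, hT₀⟩ := exists_policy_of_legal_partition E m P hne hdisj hcover hU1strong hU2obs U₂
    hU₂ hU₂ne δstar hδ
  refine ⟨T₀, fun T hT => ?_⟩
  obtain ⟨π, hπ⟩ := hT₀ T hT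
  refine ⟨π, fun ℓ hℓ a k hak => ?_⟩
  have hreg := regret_bound_le (Finset.sum_nonneg fun _ _ => Real.sqrt_nonneg _)
    (Nat.cast_nonneg _) (by positivity) (Nat.cast_nonneg _) (hπ ℓ hℓ a k hak)
  refine ⟨fun _ => hreg.trans (le_add_of_nonneg_right (by positivity)), fun _ => ?_⟩
  have h1 := mul_le_mul_of_nonneg_right two_rpow_two_thirds_le
    (show 0 ≤ ((U₂.card : ℝ) * ∑ k ∈ U₂, δstar k ^ 2) ^ ((1 : ℝ) / 6) *
      (T : ℝ) ^ ((2 : ℝ) / 3) by positivity)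
  have e1 : 0 ≤ 4 * √(6 * (U₁S.card : ℝ)) * (T : ℝ) ^ ((1 : ℝ) / 2) := by positivity
  have e2 : 0 ≤ 2 * √(10 * Real.log ((U₁Sb.card : ℝ) + 1)) * (T : ℝ) ^ ((1 : ℝ) / 2) := by
    positivity
  have e3 : 0 ≤ 4 * (U₂.card : ℝ) ^ ((5 : ℝ) / 6) * (T : ℝ) ^ ((1 : ℝ) / 3) /
      (2 ^ ((1 : ℝ) / 3) * (∑ k ∈ U₂, δstar k ^ 2) ^ ((1 : ℝ) / 6)) := by positivity
  have e4 : 0 ≤ √6 / 3 * (T : ℝ) ^ ((1 : ℝ) / 2) := by positivity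
  refine hreg.trans ?_
  generalize ((U₂.card : ℝ) * ∑ k ∈ U₂, δstar k ^ 2) ^ ((1 : ℝ) / 6) = D at *
  generalize 4 * √(6 * (U₁S.card : ℝ)) * (T : ℝ) ^ ((1 : ℝ) / 2) = r₁ at *
  generalize 2 * √(10 * Real.log ((U₁Sb.card : ℝ) + 1)) * (T : ℝ) ^ ((1 : ℝ) / 2) = r₂ at *
  generalize 4 * (U₂.card : ℝ) ^ ((5 : ℝ) / 6) * (T : ℝ) ^ ((1 : ℝ) / 3) /
      (2 ^ ((1 : ℝ) / 3) * (∑ k ∈ U₂, δstar k ^ 2) ^ ((1 : ℝ) / 6)) = r₃ at *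
  generalize √6 / 3 * (T : ℝ) ^ ((1 : ℝ) / 2) = r₄ at *
  generalize (3 * (2 * ∑ k ∈ U₂, √((P k).card : ℝ)) ^ ((1 : ℝ) / 3) *
    ((P k).card : ℝ) ^ ((1 : ℝ) / 6) * (T : ℝ) ^ ((2 : ℝ) / 3)) = r₅ at *
  generalize (T : ℝ) ^ ((2 : ℝ) / 3) = y at *
  linarith
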